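/- arXiv:1402.4323 — 2 statements merged into one kernel-verified Lean document; each statement's English description precedes it below -/
import Mathlib

section
/- Let u be a harmonic function in the unit ball B₁ ⊂ ℝⁿ which is not identically zero. Then the Almgren frequency N(r) = r D(r)/H(r) is a nondecreasing function of r on (0,1). -/
open MeasureTheory Metric Set

noncomputable section

/-- The Euclidean Laplacian of `u : ℝⁿ → ℝ` at `x`. -/
def lap {n : ℕ} (u : EuclideanSpace ℝ (Fin n) → ℝ) (x : EuclideanSpace ℝ (Fin n)) : ℝ :=
  ∑ i : Fin n,
    fderiv ℝ (fun y => fderiv ℝ u y (EuclideanSpace.single i 1)) x (EuclideanSpace.single i 1)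

/-- `u` is harmonic on the open ball of radius `R` centred at the origin. -/
def HarmonicOnBall {n : ℕ} (u : EuclideanSpace ℝ (Fin n) → ℝ) (R : ℝ) : Prop :=
  ContDiffOn ℝ 2 u (ball (0 : EuclideanSpace ℝ (Fin n)) R) ∧
  ∀ x ∈ ball (0 : EuclideanSpace ℝ (Fin n)) R, lap u x = 0

/-- `H(r) = ∫_{∂B_r} u² dσ`, the boundary integral of `u²` over the sphere of
radius `r` centred at the origin (with respect to `(n-1)`-dimensional Hausdorff
measure, i.e. surface measure). -/
def sphH (n : ℕ) (u : EuclideanSpace ℝ (Fin n) → ℝ) (r : ℝ) : ℝ :=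
  ∫ x in sphere (0 : EuclideanSpace ℝ (Fin n)) r, (u x) ^ 2 ∂μH[(n : ℝ) - 1]

/-- `D(r) = ∫_{B_r} |∇u|² dx`. -/
def dirD {n : ℕ} (u : EuclideanSpace ℝ (Fin n) → ℝ) (r : ℝ) : ℝ :=
  ∫ x in ball (0 : EuclideanSpace ℝ (Fin n)) r, ‖gradient u x‖ ^ 2

/-- The Almgren frequency `N(r) = r D(r) / H(r)`. -/
def freqN (n : ℕ) (u : EuclideanSpace ℝ (Fin n) → ℝ) (r : ℝ) : ℝ :=
  r * dirD u r / sphH n u r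

open scoped Topology

/-- Differentiation under the integral sign over a compact space. -/
theorem hasDerivAt_integral_of_continuousOn_deriv {α : Type*} [TopologicalSpace α]
    [CompactSpace α] [MeasurableSpace α] [OpensMeasurableSpace α] (μ : Measure α)
    [IsFiniteMeasure μ] {F F' : ℝ → α → ℝ} {U : Set ℝ} (hU : IsOpen U)
    (hF : ∀ t ∈ U, Continuous (F t))
    (hd : ∀ t ∈ U, ∀ x, HasDerivAt (fun s => F s x) (F' t x) t)
    (hF' : ContinuousOn (fun p : ℝ × α => F' p.1 p.2) (U ×ˢ univ)) {t : ℝ} (ht : t ∈ U) :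
    HasDerivAt (fun s => ∫ x, F s x ∂μ) (∫ x, F' t x ∂μ) t := by
  obtain ⟨K, hK, hKt, hKU⟩ := exists_compact_subset hU ht
  have hKn : K ∈ 𝓝 t := mem_interior_iff_mem_nhds.1 hKt
  obtain ⟨M, hM⟩ := (hK.prod isCompact_univ).exists_bound_of_continuousOn
    (hF'.mono (prod_mono hKU Subset.rfl))
  have hcont : ∀ s ∈ U, Continuous (F' s) := fun s hs =>
    hF'.comp_continuous (Continuous.prodMk_right s) fun x => ⟨hs, mem_univ x⟩
  have hint : ∀ f : α → ℝ, Continuous f → Integrable f μ := fun f hf =>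
    hf.integrable_of_hasCompactSupport (HasCompactSupport.of_compactSpace f)
  exact (hasDerivAt_integral_of_dominated_loc_of_deriv_le (bound := fun _ => M) hKn
    (Filter.eventually_of_mem (hU.mem_nhds ht) fun s hs => (hint _ (hF s hs)).aestronglyMeasurable)
    (hint _ (hF t ht)) (hint _ (hcont t ht)).aestronglyMeasurable
    (ae_of_all _ fun x s hs => hM (s, x) ⟨hs, mem_univ x⟩) (integrable_const M)
    (ae_of_all _ fun x s hs => hd s (hKU hs) x)).2

/-- Continuity of an integral over a compact space in a parameter. -/
theorem continuousOn_integral_of_compactSpace {α : Type*} [TopologicalSpace α]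
    [CompactSpace α] [MeasurableSpace α] [OpensMeasurableSpace α] (μ : Measure α)
    [IsFiniteMeasure μ] {F : ℝ → α → ℝ} {U : Set ℝ} (hU : IsOpen U)
    (hF : ContinuousOn (fun p : ℝ × α => F p.1 p.2) (U ×ˢ univ)) :
    ContinuousOn (fun s => ∫ x, F s x ∂μ) U := by
  intro t ht
  obtain ⟨K, hK, hKt, hKU⟩ := exists_compact_subset hU ht
  have hKn : K ∈ 𝓝 t := mem_interior_iff_mem_nhds.1 hKt
  obtain ⟨M, hM⟩ := (hK.prod isCompact_univ).exists_bound_of_continuousOn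
    (hF.mono (prod_mono hKU Subset.rfl))
  refine ContinuousAt.continuousWithinAt ?_
  refine continuousAt_of_dominated (bound := fun _ => M) ?_ ?_ (integrable_const M) ?_
  · filter_upwards [hU.mem_nhds ht] with s hs
    have h : Continuous (F s) :=
      hF.comp_continuous (Continuous.prodMk_right s) fun x => ⟨hs, mem_univ x⟩
    exact (h.integrable_of_hasCompactSupport
      (HasCompactSupport.of_compactSpace _)).aestronglyMeasurable
  · filter_upwards [hKn] with s hs
    exact ae_of_all _ fun x => hM (s, x) ⟨hs, mem_univ x⟩
  · refine ae_of_all _ fun x => ?_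
    exact (hF.continuousAt ((hU.prod isOpen_univ).mem_nhds ⟨ht, mem_univ x⟩)).comp
      (f := fun s => (s, x)) (Continuous.prodMk_left x).continuousAt

/-- On a compact metric space with a transitive family of isometries, two invariant measures agree
up to a constant on nonnegative continuous functions. If `μ` is infinite, then `c = 0` and both
sides vanish, since a nonnegative continuous function that is not `0` is not `μ`-integrable. -/
theorem exists_integral_eq_mul_integral_of_transitive {X : Type*} [MetricSpace X] [CompactSpace X]
    [MeasurableSpace X] [BorelSpace X] (μ ν : Measure X) [IsFiniteMeasure ν]
    [ν.IsOpenPosMeasure]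
    (h : ∀ x y : X, ∃ g : X ≃ᵢ X, g x = y ∧ μ.map g = μ ∧ ν.map g = ν) :
    ∃ c : ℝ, 0 ≤ c ∧ ∀ f : X → ℝ, Continuous f → 0 ≤ f → ∫ x, f x ∂μ = c * ∫ x, f x ∂ν := by
  rcases isEmpty_or_nonempty X with hX | ⟨⟨x₀⟩⟩
  · exact ⟨0, le_rfl, fun f _ _ => by simp [Measure.eq_zero_of_isEmpty]⟩
  have hball : ∀ (κ : Measure X), (∀ x y : X, ∃ g : X ≃ᵢ X, g x = y ∧ κ.map g = κ) →
      ∀ x y δ, κ (ball x δ) = κ (ball y δ) := by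
    intro κ hκ x y δ
    obtain ⟨g, rfl, hg⟩ := hκ x y
    conv_rhs => rw [← hg]
    rw [Measure.map_apply g.continuous.measurable measurableSet_ball, g.preimage_ball]
    simp
  have hμb := hball μ fun x y => (h x y).imp fun g hg => ⟨hg.1, hg.2.1⟩
  have hνb := hball ν fun x y => (h x y).imp fun g hg => ⟨hg.1, hg.2.2⟩
  by_cases hfin : μ univ = ⊤
  · refine ⟨0, le_rfl, fun f hf h0 => ?_⟩
    rw [zero_mul]
    by_contra hne
    have hint : Integrable f μ := by
      by_contra hni
      exact hne (integral_undef hni)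
    obtain ⟨x, hx⟩ : ∃ x, f x ≠ 0 := by
      by_contra hall
      push Not at hall
      exact hne (by simp [hall])
    have hx0 : 0 < f x := lt_of_le_of_ne (h0 x) (Ne.symm hx)
    obtain ⟨δ, hδ, hδf⟩ := Metric.isOpen_iff.1 (isOpen_lt continuous_const hf) x
      (show f x / 2 < f x by linarith)
    have hlt : μ (ball x δ) < ⊤ :=
      (measure_mono hδf).trans_lt (hint.measure_gt_lt_top (half_pos hx0))
    have : μ univ < ⊤ := isCompact_univ.measure_lt_top_of_nhdsWithin fun y _ =>
      ⟨ball y δ, mem_nhdsWithin_of_mem_nhds (ball_mem_nhds y hδ), by rwa [hμb y x]⟩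
    exact this.ne hfin
  have : IsFiniteMeasure μ := ⟨lt_top_iff_ne_top.2 hfin⟩
  have : Nonempty X := ⟨x₀⟩
  have hνX : 0 < ν.real univ :=
    ENNReal.toReal_pos (isOpen_univ.measure_ne_zero ν univ_nonempty) (measure_ne_top _ _)
  refine ⟨μ.real univ / ν.real univ, by positivity, fun f hf _ => ?_⟩
  have hfμ : Integrable f μ :=
    hf.integrable_of_hasCompactSupport (HasCompactSupport.of_compactSpace f)
  have hfν : Integrable f ν :=
    hf.integrable_of_hasCompactSupport (HasCompactSupport.of_compactSpace f)
  have key : ∀ δ > 0, ∀ f : X → ℝ, Continuous f →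
      (∫ p in {p : X × X | dist p.1 p.2 < δ}, f p.1 ∂(μ.prod ν)
          = ν.real (ball x₀ δ) * ∫ x, f x ∂μ) ∧
      (∫ p in {p : X × X | dist p.1 p.2 < δ}, f p.2 ∂(μ.prod ν)
          = μ.real (ball x₀ δ) * ∫ x, f x ∂ν) := by
    intro δ hδ f hf
    have hA : MeasurableSet {p : X × X | dist p.1 p.2 < δ} :=
      (isOpen_lt (by fun_prop) (by fun_prop)).measurableSet
    have hi1 : Integrable (fun p : X × X => f p.1) (μ.prod ν) :=
      (hf.comp continuous_fst).integrable_of_hasCompactSupport (HasCompactSupport.of_compactSpace _)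
    have hi2 : Integrable (fun p : X × X => f p.2) (μ.prod ν) :=
      (hf.comp continuous_snd).integrable_of_hasCompactSupport (HasCompactSupport.of_compactSpace _)
    constructor
    · rw [← integral_indicator hA, integral_prod _ (hi1.indicator hA), ← integral_const_mul]
      refine integral_congr_ae (ae_of_all _ fun x => ?_)
      have : (fun y => {p : X × X | dist p.1 p.2 < δ}.indicator (fun p => f p.1) (x, y))
          = (ball x δ).indicator (fun _ => f x) := by
        ext y
        simp [indicator, dist_comm]
      simp only [this]
      rw [integral_indicator measurableSet_ball, setIntegral_const, smul_eq_mul, Measure.real,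
        hνb x x₀, Measure.real]
    · rw [← integral_indicator hA, integral_prod_symm _ (hi2.indicator hA), ← integral_const_mul]
      refine integral_congr_ae (ae_of_all _ fun y => ?_)
      have : (fun x => {p : X × X | dist p.1 p.2 < δ}.indicator (fun p => f p.2) (x, y))
          = (ball y δ).indicator (fun _ => f y) := by
        ext x
        simp [indicator]
      simp only [this]
      rw [integral_indicator measurableSet_ball, setIntegral_const, smul_eq_mul, Measure.real,
        hμb y x₀, Measure.real]
  have hest : ∀ ε > 0, |∫ x, f x ∂μ - μ.real univ / ν.real univ * ∫ x, f x ∂ν|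
      ≤ ε * μ.real univ := by
    intro ε hε
    obtain ⟨δ, hδ, hfδ⟩ := Metric.uniformContinuous_iff.1
      (CompactSpace.uniformContinuous_of_continuous hf) ε hε
    obtain ⟨k1, k2⟩ := key δ hδ f hf
    obtain ⟨c1, c2⟩ := key δ hδ (fun _ => 1) continuous_const
    have hgh : ν.real (ball x₀ δ) * μ.real univ = μ.real (ball x₀ δ) * ν.real univ := by
      have := c1.symm.trans c2
      simpa using this
    have hh : 0 < ν.real (ball x₀ δ) :=
      ENNReal.toReal_pos (isOpen_ball.measure_ne_zero ν ⟨x₀, mem_ball_self hδ⟩)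
        (measure_ne_top _ _)
    have hi1 : Integrable (fun p : X × X => f p.1) (μ.prod ν) :=
      (hf.comp continuous_fst).integrable_of_hasCompactSupport (HasCompactSupport.of_compactSpace _)
    have hi2 : Integrable (fun p : X × X => f p.2) (μ.prod ν) :=
      (hf.comp continuous_snd).integrable_of_hasCompactSupport (HasCompactSupport.of_compactSpace _)
    have hd : ‖∫ p in {p : X × X | dist p.1 p.2 < δ}, (f p.1 - f p.2) ∂(μ.prod ν)‖
        ≤ ε * (μ.prod ν).real {p : X × X | dist p.1 p.2 < δ} := by
      refine norm_setIntegral_le_of_norm_le_const (measure_lt_top _ _) fun p hp => ?_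
      exact (hfδ hp).le
    rw [integral_sub hi1.integrableOn hi2.integrableOn, k1, k2] at hd
    have hA : (μ.prod ν).real {p : X × X | dist p.1 p.2 < δ}
        = ν.real (ball x₀ δ) * μ.real univ := by simpa using c1
    rw [hA, Real.norm_eq_abs] at hd
    have hg : μ.real (ball x₀ δ) = ν.real (ball x₀ δ) * (μ.real univ / ν.real univ) := by
      field_simp
      linarith
    rw [hg, mul_assoc, ← mul_sub, abs_mul, abs_of_pos hh] at hd
    refine le_of_mul_le_mul_left ?_ hh
    linarith
  refine eq_of_abs_sub_nonpos (le_of_forall_pos_le_add fun η hη => ?_)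
  rw [zero_add]
  refine (hest (η / (μ.real univ + 1)) (by positivity)).trans ?_
  rw [div_mul_eq_mul_div, div_le_iff₀ (by positivity)]
  nlinarith [measureReal_nonneg (μ := μ) (s := univ)]

/-- A linear isometry acts on the unit sphere. -/
def LinearIsometryEquiv.unitSphere {E : Type*} [NormedAddCommGroup E] [InnerProductSpace ℝ E]
    (g : E ≃ₗᵢ[ℝ] E) : sphere (0 : E) 1 ≃ᵢ sphere (0 : E) 1 :=
  IsometryEquiv.mk' (fun x => ⟨g x, by simp⟩) (fun x => ⟨g.symm x, by simp⟩)
    (fun x => by simp) (fun x y => by simp [Subtype.edist_eq, g.edist_map])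

@[simp]
theorem LinearIsometryEquiv.coe_unitSphere {E : Type*} [NormedAddCommGroup E]
    [InnerProductSpace ℝ E] (g : E ≃ₗᵢ[ℝ] E) (x : sphere (0 : E) 1) :
    (g.unitSphere x : E) = g x := rfl

open scoped Pointwise in
/-- The surface measure of the unit sphere is invariant under linear isometries. -/
theorem map_unitSphere_toSphere {E : Type*} [NormedAddCommGroup E] [InnerProductSpace ℝ E]
    [FiniteDimensional ℝ E] [MeasurableSpace E] [BorelSpace E] (g : E ≃ₗᵢ[ℝ] E) :
    (volume : Measure E).toSphere.map g.unitSphere = (volume : Measure E).toSphere := by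
  have hm : Measurable g.unitSphere := g.unitSphere.continuous.measurable
  ext s hs
  rw [Measure.map_apply hm hs, Measure.toSphere_apply' _ hs, Measure.toSphere_apply' _ (hm hs)]
  congr 1
  have : Ioo (0 : ℝ) 1 • (((↑) : sphere (0 : E) 1 → E) '' s)
      = g.symm ⁻¹' (Ioo (0 : ℝ) 1 • (((↑) : sphere (0 : E) 1 → E) '' (g.unitSphere ⁻¹' s))) := by
    ext x
    simp only [mem_smul, mem_image, mem_preimage]
    constructor
    · rintro ⟨t, ht, _, ⟨y, hy, rfl⟩, rfl⟩
      refine ⟨t, ht, g.symm y, ⟨g.symm.unitSphere y, ?_, rfl⟩, by simp⟩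
      convert hy
      ext
      simp
    · rintro ⟨t, ht, _, ⟨y, hy, rfl⟩, h⟩
      refine ⟨t, ht, g y, ⟨_, hy, rfl⟩, ?_⟩
      rw [← map_smul, h, g.apply_symm_apply]
  rw [this, g.symm.measurePreserving.measure_preimage_emb
    g.symm.toHomeomorph.measurableEmbedding]

theorem integral_unitSphere_comp {E : Type*} [NormedAddCommGroup E] [InnerProductSpace ℝ E]
    [FiniteDimensional ℝ E] [MeasurableSpace E] [BorelSpace E] (g : E ≃ₗᵢ[ℝ] E)
    (f : sphere (0 : E) 1 → ℝ) :
    ∫ x, f (g.unitSphere x) ∂(volume : Measure E).toSphere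
      = ∫ x, f x ∂(volume : Measure E).toSphere := by
  conv_rhs => rw [← map_unitSphere_toSphere g]
  exact (g.unitSphere.toHomeomorph.measurableEmbedding.integral_map _).symm

theorem exists_unitSphere_apply_eq {E : Type*} [NormedAddCommGroup E] [InnerProductSpace ℝ E]
    (x y : sphere (0 : E) 1) : ∃ g : E ≃ₗᵢ[ℝ] E, g.unitSphere x = y :=
  ⟨(ℝ ∙ ((x : E) - y))ᗮ.reflection, Subtype.ext
    (Submodule.reflection_sub (by simp))⟩

open scoped Pointwise in
theorem hausdorffMeasure_eq_smul_map_smul {E : Type*} [NormedAddCommGroup E] [NormedSpace ℝ E]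
    [MeasurableSpace E] [BorelSpace E] {d r : ℝ} (hd : 0 ≤ d) (hr : 0 < r) :
    (μH[d] : Measure E) = ENNReal.ofReal (r ^ d) • (μH[d] : Measure E).map (r • ·) := by
  ext s hs
  have hpre : (fun x : E => r • x) ⁻¹' s = r⁻¹ • s := preimage_smul₀ hr.ne' s
  rw [Measure.smul_apply, Measure.map_apply (measurable_const_smul r) hs, hpre,
    Measure.hausdorffMeasure_smul₀ hd (inv_ne_zero hr.ne'), ENNReal.smul_def, smul_smul,
    smul_eq_mul]
  have : ENNReal.ofReal (r ^ d) * ((‖r⁻¹‖₊ ^ d : NNReal) : ENNReal) = 1 := by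
    rw [ENNReal.ofReal, ← ENNReal.coe_mul, ENNReal.coe_eq_one]
    ext
    rw [NNReal.coe_mul, Real.coe_toNNReal _ (by positivity), NNReal.coe_rpow, coe_nnnorm,
      norm_inv, Real.norm_of_nonneg hr.le, Real.inv_rpow hr.le, NNReal.coe_one]
    exact mul_inv_cancel₀ (by positivity)
  rw [this, one_mul]

/-- Rescaling the Hausdorff integral over the sphere of radius `r` to the unit sphere. -/
theorem setIntegral_sphere_hausdorffMeasure {E : Type*} [NormedAddCommGroup E] [NormedSpace ℝ E]
    [MeasurableSpace E] [BorelSpace E] {d r : ℝ} (hd : 0 ≤ d) (hr : 0 < r) (f : E → ℝ) :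
    ∫ x in sphere (0 : E) r, f x ∂μH[d]
      = r ^ d * ∫ x : sphere (0 : E) 1, f (r • (x : E)) ∂μH[d] := by
  have hpre : (fun x : E => r • x) ⁻¹' sphere (0 : E) r = sphere 0 1 := by
    ext x
    simp [norm_smul, abs_of_pos hr, hr.ne']
  have hemb : MeasurableEmbedding (fun x : E => r • x) :=
    (Homeomorph.smulOfNeZero r hr.ne').measurableEmbedding
  rw [hausdorffMeasure_eq_smul_map_smul hd hr, Measure.restrict_smul, integral_smul_measure,
    hemb.setIntegral_map, hpre, ENNReal.toReal_ofReal (by positivity), smul_eq_mul]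
  congr 1
  have := (isometry_subtype_coe (s := sphere (0 : E) 1)).map_hausdorffMeasure (d := d) (Or.inl hd)
  rw [Subtype.range_coe] at this
  rw [← this, (MeasurableEmbedding.subtype_coe isClosed_sphere.measurableSet).integral_map]

theorem smul_unitSphere_mem_ball {E : Type*} [NormedAddCommGroup E] [NormedSpace ℝ E] {r R : ℝ}
    (hr : |r| < R) (x : sphere (0 : E) 1) : r • (x : E) ∈ ball (0 : E) R := by
  simpa [norm_smul] using hr

/-- Infinitesimal rotation invariance of the surface measure. -/
theorem integral_fderiv_rotation_eq_zero {E : Type*} [NormedAddCommGroup E]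
    [InnerProductSpace ℝ E] [FiniteDimensional ℝ E] [MeasurableSpace E] [BorelSpace E]
    {f : E → ℝ} {R r : ℝ} (hf : ContDiffOn ℝ 1 f (ball 0 R)) (hr : 0 < r) (hrR : r < R)
    (a b : E) :
    ∫ x : sphere (0 : E) 1, fderiv ℝ f (r • (x : E))
      (inner ℝ b (x : E) • a - inner ℝ a (x : E) • b) ∂(volume : Measure E).toSphere = 0 := by
  set A : E →L[ℝ] E := (innerSL ℝ b).smulRight a - (innerSL ℝ a).smulRight b with hA
  have hAx : ∀ x, A x = inner ℝ b x • a - inner ℝ a x • b := fun x => by simp [hA]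
  have hskew : A ∈ skewAdjoint (E →L[ℝ] E) := by
    rw [skewAdjoint.mem_iff, ContinuousLinearMap.star_eq_adjoint]
    refine ((ContinuousLinearMap.eq_adjoint_iff _ _).2 fun x y => ?_).symm
    simp only [neg_apply, hAx, inner_neg_left, inner_sub_left, inner_sub_right,
      inner_smul_left, inner_smul_right, RCLike.conj_to_real, real_inner_comm x]
    ring
  let _ : NormedAlgebra ℚ (E →L[ℝ] E) := NormedAlgebra.restrictScalars ℚ ℝ _
  have hU : ∀ t : ℝ, NormedSpace.exp (t • A) ∈ unitary (E →L[ℝ] E) := fun t =>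
    NormedSpace.exp_mem_unitary_of_mem_skewAdjoint (skewAdjoint.smul_mem t hskew)
  let g : ℝ → E ≃ₗᵢ[ℝ] E := fun t => Unitary.linearIsometryEquiv ⟨_, hU t⟩
  have hg : ∀ t x, g t x = NormedSpace.exp (t • A) x := fun t x => rfl
  have hmem : ∀ t (x : sphere (0 : E) 1), r • g t x ∈ ball (0 : E) R := fun t x =>
    smul_unitSphere_mem_ball (by rwa [abs_of_pos hr]) ((g t).unitSphere x)
  have hexp : Continuous fun p : ℝ × sphere (0 : E) 1 => g p.1 p.2 := by
    have h1 : Continuous fun t : ℝ => NormedSpace.exp (t • A) :=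
      (NormedSpace.exp_continuous).comp (by fun_prop)
    exact (h1.comp continuous_fst).clm_apply (continuous_subtype_val.comp continuous_snd)
  have hfd : ContinuousOn (fderiv ℝ f) (ball 0 R) :=
    hf.continuousOn_fderiv_of_isOpen isOpen_ball le_rfl
  have hderiv := hasDerivAt_integral_of_continuousOn_deriv (volume : Measure E).toSphere
    (F := fun t x => f (r • g t x)) (F' := fun t x => fderiv ℝ f (r • g t x) (r • A (g t x)))
    isOpen_univ
    (fun t _ => hf.continuousOn.comp_continuous
      (((g t).continuous.comp continuous_subtype_val).const_smul r) (hmem t))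
    (fun t _ x => by
      have h1 : HasDerivAt (fun s : ℝ => g s x) (A (g t x)) t := by
        simpa using! (hasDerivAt_exp_smul_const' A t).clm_apply (hasDerivAt_const t (x : E))
      exact (((hf.contDiffAt (isOpen_ball.mem_nhds (hmem t x))).differentiableAt
        one_ne_zero).hasFDerivAt).comp_hasDerivAt t (h1.const_smul r))
    (Continuous.continuousOn ((hfd.comp_continuous (hexp.const_smul r)
      fun p => hmem p.1 p.2).clm_apply ((A.continuous.comp hexp).const_smul r)))
    (mem_univ (0 : ℝ))
  have hconst : (fun t => ∫ x : sphere (0 : E) 1, f (r • g t x) ∂(volume : Measure E).toSphere)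
      = fun _ => ∫ x : sphere (0 : E) 1, f (r • (x : E)) ∂(volume : Measure E).toSphere := by
    ext t
    exact integral_unitSphere_comp (g t) fun x => f (r • (x : E))
  rw [hconst] at hderiv
  have h0 := hderiv.unique (hasDerivAt_const _ _)
  have hg0 : ∀ x, g 0 x = x := fun x => by simp [hg]
  simp only [hg0, map_smul, smul_eq_mul, integral_const_mul, hAx] at h0
  exact (mul_eq_zero.1 h0).resolve_left hr.ne'

/-- Integration over a ball in polar coordinates. -/
theorem setIntegral_ball_eq_intervalIntegral_unitSphere {E : Type*} [NormedAddCommGroup E]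
    [NormedSpace ℝ E] [FiniteDimensional ℝ E] [Nontrivial E] [MeasurableSpace E] [BorelSpace E]
    (μ : Measure E) [μ.IsAddHaarMeasure] {f : E → ℝ} {ρ : ℝ} (hρ : 0 ≤ ρ)
    (hf : IntegrableOn f (ball 0 ρ) μ) :
    ∫ x in ball 0 ρ, f x ∂μ = ∫ r in (0 : ℝ)..ρ, r ^ (Module.finrank ℝ E - 1) *
      ∫ x : sphere (0 : E) 1, f (r • (x : E)) ∂μ.toSphere := by
  set h : E → ℝ := (ball 0 ρ).indicator f with hh
  have hint : Integrable h μ := hf.integrable_indicator measurableSet_ball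
  have hmp := μ.measurePreserving_homeomorphUnitSphereProd
  have hemb := (homeomorphUnitSphereProd E).measurableEmbedding
  set k : sphere (0 : E) 1 × Ioi (0 : ℝ) → ℝ := fun p => h ((p.2 : ℝ) • (p.1 : E)) with hk
  have hkh : ∀ x : ({0}ᶜ : Set E), k (homeomorphUnitSphereProd E x) = h x := by
    intro x
    have hx : ‖(x : E)‖ ≠ 0 := norm_ne_zero_iff.2 x.2
    simp [hk, smul_smul, hx]
  have hs : MeasurableSet ({0}ᶜ : Set E) := (measurableSet_singleton _).compl
  have hkint : Integrable k (μ.toSphere.prod (.volumeIoiPow (Module.finrank ℝ E - 1))) := by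
    rw [← hmp.integrable_comp_emb hemb]
    have : k ∘ homeomorphUnitSphereProd E = h ∘ Subtype.val := funext hkh
    rw [this, ← (MeasurableEmbedding.subtype_coe hs).integrable_map_iff,
      map_comap_subtype_coe hs]
    exact hint.integrableOn
  calc ∫ x in ball 0 ρ, f x ∂μ = ∫ x, h x ∂μ := (integral_indicator measurableSet_ball).symm
    _ = ∫ x : ({0}ᶜ : Set E), h x ∂(μ.comap (↑)) := by
      rw [integral_subtype_comap hs h, restrict_compl_singleton]
    _ = ∫ p, k p ∂(μ.toSphere.prod (.volumeIoiPow (Module.finrank ℝ E - 1))) := by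
      rw [← hmp.integral_comp hemb]
      simp only [hkh]
    _ = ∫ r : Ioi (0 : ℝ), ∫ x, k (x, r) ∂μ.toSphere
        ∂(.volumeIoiPow (Module.finrank ℝ E - 1)) := integral_prod_symm _ hkint
    _ = ∫ r in Ioi (0 : ℝ), r ^ (Module.finrank ℝ E - 1) *
        ∫ x : sphere (0 : E) 1, h (r • (x : E)) ∂μ.toSphere := by
      simp only [Measure.volumeIoiPow, ENNReal.ofReal]
      rw [integral_withDensity_eq_integral_smul,
        integral_subtype_comap measurableSet_Ioi fun a : ℝ =>
          Real.toNNReal (a ^ (Module.finrank ℝ E - 1)) •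
            ∫ x : sphere (0 : E) 1, h (a • (x : E)) ∂μ.toSphere,
        setIntegral_congr_fun measurableSet_Ioi fun x hx ↦ ?_]
      · rw [NNReal.smul_def, Real.coe_toNNReal _ (pow_nonneg (le_of_lt hx) _), smul_eq_mul]
      · exact (measurable_subtype_coe.pow_const _).real_toNNReal
    _ = ∫ r in Ioi (0 : ℝ), (Iio ρ).indicator (fun r => r ^ (Module.finrank ℝ E - 1) *
        ∫ x : sphere (0 : E) 1, f (r • (x : E)) ∂μ.toSphere) r := by
      refine setIntegral_congr_fun measurableSet_Ioi fun r hr => ?_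
      have hr' : |r| = r := abs_of_pos hr
      by_cases hrρ : r < ρ
      · simp [hh, indicator, norm_smul, hr', hrρ]
      · simp [hh, indicator, norm_smul, hr', hrρ]
    _ = _ := by
      rw [setIntegral_indicator measurableSet_Iio, Ioi_inter_Iio,
        intervalIntegral.integral_of_le hρ, integral_Ioc_eq_integral_Ioo]

theorem ContinuousOn.comp_smul_unitSphere {E F : Type*} [NormedAddCommGroup E] [NormedSpace ℝ E]
    [TopologicalSpace F] {f : E → F} {R : ℝ} (hf : ContinuousOn f (ball 0 R)) :
    ContinuousOn (fun p : ℝ × sphere (0 : E) 1 => f (p.1 • (p.2 : E))) (Ioo (-R) R ×ˢ univ) :=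
  hf.comp (by fun_prop) fun p hp => smul_unitSphere_mem_ball (abs_lt.2 hp.1) p.2

theorem ContinuousOn.continuous_comp_smul_unitSphere {E F : Type*} [NormedAddCommGroup E]
    [NormedSpace ℝ E] [TopologicalSpace F] {f : E → F} {r R : ℝ} (hf : ContinuousOn f (ball 0 R))
    (hr : |r| < R) : Continuous fun x : sphere (0 : E) 1 => f (r • (x : E)) :=
  hf.comp_continuous (by fun_prop) fun x => smul_unitSphere_mem_ball hr x

theorem Continuous.integrable_of_compactSpace {α : Type*} [TopologicalSpace α] [CompactSpace α]
    [MeasurableSpace α] [OpensMeasurableSpace α] {μ : Measure α} [IsFiniteMeasure μ]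
    {f : α → ℝ} (hf : Continuous f) : Integrable f μ :=
  hf.integrable_of_hasCompactSupport (HasCompactSupport.of_compactSpace f)

/-- The derivative of `t ↦ f (t • x)` for `f` of class `C¹` near `r • x`. -/
theorem ContDiffOn.hasDerivAt_comp_smul {E : Type*} [NormedAddCommGroup E] [NormedSpace ℝ E]
    {f : E → ℝ} {R r : ℝ} (hf : ContDiffOn ℝ 1 f (ball 0 R)) (hr : |r| < R)
    (x : sphere (0 : E) 1) :
    HasDerivAt (fun t : ℝ => f (t • (x : E))) (fderiv ℝ f (r • (x : E)) x) r := by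
  have h1 : HasDerivAt (fun t : ℝ => t • (x : E)) (x : E) r := by
    simpa using (hasDerivAt_id r).smul_const (x : E)
  exact (((hf.contDiffAt (isOpen_ball.mem_nhds (smul_unitSphere_mem_ball hr x))).differentiableAt
    one_ne_zero).hasFDerivAt).comp_hasDerivAt r h1

/-- The surface measure of the unit sphere of `ℝⁿ`. -/
abbrev unitSphereMeasure (n : ℕ) : Measure (sphere (0 : EuclideanSpace ℝ (Fin n)) 1) :=
  (volume : Measure (EuclideanSpace ℝ (Fin n))).toSphere

theorem EuclideanSpace.clm_apply_eq_sum {n : ℕ} (L : EuclideanSpace ℝ (Fin n) →L[ℝ] ℝ)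
    (w : EuclideanSpace ℝ (Fin n)) : L w = ∑ i, w i * L (EuclideanSpace.single i 1) := by
  conv_lhs => rw [← (EuclideanSpace.basisFun (Fin n) ℝ).sum_repr w]
  simp

theorem sum_sum_rotation_eq {n : ℕ} (r : ℝ) (w : EuclideanSpace ℝ (Fin n)) (hw : ‖w‖ = 1)
    (c : Fin n → ℝ) (L : Fin n → EuclideanSpace ℝ (Fin n) →L[ℝ] ℝ) :
    ∑ i, ∑ j, ((w i * (if i = j then 1 else 0) - w j) * c j
      + r * w i * L j (w i • EuclideanSpace.single j 1 - w j • EuclideanSpace.single i 1))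
    = (1 - n) * ∑ j, w j * c j
      + r * (∑ j, L j (EuclideanSpace.single j 1) - ∑ j, w j * L j w) := by
  have hw2 : ∑ i, w i * w i = 1 := by
    have := EuclideanSpace.real_norm_sq_eq w
    rw [hw] at this
    simpa [sq] using this.symm
  have h1 : ∑ i, ∑ j, (w i * (if i = j then 1 else 0) - w j) * c j
      = (1 - n) * ∑ j, w j * c j := by
    simp [sub_mul, Finset.sum_sub_distrib]
  have h2 : ∑ i, ∑ j, w i * (w i * L j (EuclideanSpace.single j 1))
      = ∑ j, L j (EuclideanSpace.single j 1) := by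
    simp only [← mul_assoc, ← Finset.mul_sum]
    rw [← Finset.sum_mul, hw2, one_mul]
  have h3 : ∑ i, ∑ j, w i * (w j * L j (EuclideanSpace.single i 1)) = ∑ j, w j * L j w := by
    rw [Finset.sum_comm]
    refine Finset.sum_congr rfl fun j _ => ?_
    rw [EuclideanSpace.clm_apply_eq_sum (L j) w, Finset.mul_sum]
    exact Finset.sum_congr rfl fun i _ => by ring
  rw [← h1, ← h2, ← h3]
  simp only [Finset.sum_add_distrib, map_sub, map_smul, smul_eq_mul, mul_sub,
    Finset.sum_sub_distrib, Finset.mul_sum, mul_assoc]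

/-- Divergence theorem on spheres, in infinitesimal form. -/
theorem integral_unitSphere_divergence {n : ℕ} {X : Fin n → EuclideanSpace ℝ (Fin n) → ℝ} {R r : ℝ}
    (hX : ∀ j, ContDiffOn ℝ 1 (X j) (ball 0 R)) (hr : 0 < r) (hrR : r < R) :
    (1 - n) * ∫ x : sphere (0 : EuclideanSpace ℝ (Fin n)) 1,
        ∑ j, x.1 j * X j (r • x.1) ∂unitSphereMeasure n
      + r * (∫ x : sphere (0 : EuclideanSpace ℝ (Fin n)) 1,
        ∑ j, fderiv ℝ (X j) (r • x.1) (EuclideanSpace.single j 1)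
          ∂unitSphereMeasure n
      - ∫ x : sphere (0 : EuclideanSpace ℝ (Fin n)) 1,
        ∑ j, x.1 j * fderiv ℝ (X j) (r • x.1) x.1
          ∂unitSphereMeasure n) = 0 := by
  have hr' : |r| < R := by rwa [abs_of_pos hr]
  have hfd : ∀ j, Continuous fun x : sphere (0 : EuclideanSpace ℝ (Fin n)) 1 =>
      fderiv ℝ (X j) (r • x.1) := fun j =>
    ((hX j).continuousOn_fderiv_of_isOpen isOpen_ball le_rfl).continuous_comp_smul_unitSphere hr'
  have hc : ∀ j, Continuous fun x : sphere (0 : EuclideanSpace ℝ (Fin n)) 1 =>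
      X j (r • x.1) := fun j => (hX j).continuousOn.continuous_comp_smul_unitSphere hr'
  have hrot : ∀ i j, ∫ x : sphere (0 : EuclideanSpace ℝ (Fin n)) 1,
      ((x.1 i * (if i = j then 1 else 0) - x.1 j) * X j (r • x.1) + r * x.1 i *
        fderiv ℝ (X j) (r • x.1)
          (x.1 i • EuclideanSpace.single j 1 - x.1 j • EuclideanSpace.single i 1))
        ∂unitSphereMeasure n = 0 := by
    intro i j
    have hfX : ContDiffOn ℝ 1 (fun y : EuclideanSpace ℝ (Fin n) => y i * X j y) (ball 0 R) :=
      ContDiffOn.mul (ContDiff.contDiffOn (by fun_prop)) (hX j)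
    refine (integral_congr_ae (ae_of_all _ fun x => ?_)).trans (integral_fderiv_rotation_eq_zero
      hfX hr hrR (EuclideanSpace.single j 1) (EuclideanSpace.single i 1))
    have hd : HasFDerivAt (X j) (fderiv ℝ (X j) (r • x.1)) (r • x.1) :=
      (((hX j).contDiffAt (isOpen_ball.mem_nhds
        (smul_unitSphere_mem_ball hr' x))).differentiableAt one_ne_zero).hasFDerivAt
    have hp : HasFDerivAt (fun y : EuclideanSpace ℝ (Fin n) => y i)
        (EuclideanSpace.proj (𝕜 := ℝ) i) (r • x.1) :=
      (EuclideanSpace.proj (𝕜 := ℝ) i).hasFDerivAt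
    simp only [EuclideanSpace.inner_single_left, map_one, one_mul]
    rw [(hp.fun_mul hd).fderiv]
    simp
    ring
  have hint : ∀ i j, Integrable (fun x : sphere (0 : EuclideanSpace ℝ (Fin n)) 1 =>
      (x.1 i * (if i = j then 1 else 0) - x.1 j) * X j (r • x.1) + r * x.1 i *
        fderiv ℝ (X j) (r • x.1)
          (x.1 i • EuclideanSpace.single j 1 - x.1 j • EuclideanSpace.single i 1))
        (unitSphereMeasure n) := fun i j =>
    Continuous.integrable_of_compactSpace ((Continuous.mul (by fun_prop) (hc j)).add
      (Continuous.mul (by fun_prop) ((hfd j).clm_apply (by fun_prop))))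
  have hsum := integral_congr_ae (μ := (unitSphereMeasure n))
    (ae_of_all _ fun x : sphere (0 : EuclideanSpace ℝ (Fin n)) 1 =>
    sum_sum_rotation_eq r x.1 (by simp) (fun j => X j (r • x.1))
      (fun j => fderiv ℝ (X j) (r • x.1)))
  simp only [] at hsum
  rw [integral_finsetSum _ fun i _ => integrable_finsetSum _ fun j _ => hint i j] at hsum
  simp only [integral_finsetSum _ fun j _ => hint _ j, hrot, Finset.sum_const_zero] at hsum
  have i1 : Integrable (fun x : sphere (0 : EuclideanSpace ℝ (Fin n)) 1 =>
      ∑ j, x.1 j * X j (r • x.1)) (unitSphereMeasure n) :=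
    Continuous.integrable_of_compactSpace
      (continuous_finsetSum _ fun j _ => Continuous.mul (by fun_prop) (hc j))
  have i2 : Integrable (fun x : sphere (0 : EuclideanSpace ℝ (Fin n)) 1 =>
      ∑ j, fderiv ℝ (X j) (r • x.1) (EuclideanSpace.single j 1))
      (unitSphereMeasure n) :=
    Continuous.integrable_of_compactSpace
      (continuous_finsetSum _ fun j _ => (hfd j).clm_apply (by fun_prop))
  have i3 : Integrable (fun x : sphere (0 : EuclideanSpace ℝ (Fin n)) 1 =>
      ∑ j, x.1 j * fderiv ℝ (X j) (r • x.1) x.1)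
      (unitSphereMeasure n) :=
    Continuous.integrable_of_compactSpace (continuous_finsetSum _ fun j _ =>
      Continuous.mul (by fun_prop) ((hfd j).clm_apply (by fun_prop)))
  rw [integral_add (i1.const_mul _) ((i2.sub' i3).const_mul _), integral_const_mul,
    integral_const_mul, integral_sub i2 i3] at hsum
  exact hsum.symm

/-- Divergence theorem on balls, the volume integral being written in polar coordinates. -/
theorem pow_mul_integral_unitSphere_eq {n : ℕ} (hn : n ≠ 0)
    {X : Fin n → EuclideanSpace ℝ (Fin n) → ℝ} {R ρ : ℝ}
    (hX : ∀ j, ContDiffOn ℝ 1 (X j) (ball 0 R)) (hρ : 0 < ρ) (hρR : ρ < R) :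
    ρ ^ (n - 1) * ∫ x : sphere (0 : EuclideanSpace ℝ (Fin n)) 1,
        ∑ j, x.1 j * X j (ρ • x.1) ∂unitSphereMeasure n
      = ∫ r in (0 : ℝ)..ρ, r ^ (n - 1) * ∫ x : sphere (0 : EuclideanSpace ℝ (Fin n)) 1,
        ∑ j, fderiv ℝ (X j) (r • x.1) (EuclideanSpace.single j 1)
          ∂unitSphereMeasure n := by
  have hU : Icc 0 ρ ⊆ Ioo (-R) R := fun t ht => ⟨by linarith [ht.1], by linarith [ht.2]⟩
  have hfd : ∀ j, ContinuousOn (fun p : ℝ × sphere (0 : EuclideanSpace ℝ (Fin n)) 1 =>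
      fderiv ℝ (X j) (p.1 • p.2.1)) (Ioo (-R) R ×ˢ univ) := fun j =>
    ((hX j).continuousOn_fderiv_of_isOpen isOpen_ball le_rfl).comp_smul_unitSphere
  have hda : ∀ t ∈ Ioo (-R) R, HasDerivAt
      (fun r => ∫ x : sphere (0 : EuclideanSpace ℝ (Fin n)) 1, ∑ j, x.1 j * X j (r • x.1)
        ∂unitSphereMeasure n)
      (∫ x : sphere (0 : EuclideanSpace ℝ (Fin n)) 1,
        ∑ j, x.1 j * fderiv ℝ (X j) (t • x.1) x.1
          ∂unitSphereMeasure n) t := by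
    intro t ht
    refine hasDerivAt_integral_of_continuousOn_deriv _ (U := Ioo (-R) R)
      (F := fun r (x : sphere (0 : EuclideanSpace ℝ (Fin n)) 1) => ∑ j, x.1 j * X j (r • x.1))
      (F' := fun r (x : sphere (0 : EuclideanSpace ℝ (Fin n)) 1) =>
        ∑ j, x.1 j * fderiv ℝ (X j) (r • x.1) x.1) isOpen_Ioo ?_ ?_ ?_ ht
    · intro s hs
      have := fun j => (hX j).continuousOn.continuous_comp_smul_unitSphere (abs_lt.2 hs)
      exact continuous_finsetSum _ fun j _ => Continuous.mul (by fun_prop) (this j)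
    · intro s hs x
      exact HasDerivAt.fun_sum fun j _ =>
        ((hX j).hasDerivAt_comp_smul (abs_lt.2 hs) x).const_mul (x.1 j)
    · exact continuousOn_finsetSum _ fun j _ => ContinuousOn.mul (by fun_prop)
        ((hfd j).clm_apply (by fun_prop))
  have hb : ContinuousOn (fun r => ∫ x : sphere (0 : EuclideanSpace ℝ (Fin n)) 1,
      ∑ j, fderiv ℝ (X j) (r • x.1) (EuclideanSpace.single j 1)
        ∂unitSphereMeasure n) (Ioo (-R) R) :=
    continuousOn_integral_of_compactSpace _ isOpen_Ioo
      (F := fun r (x : sphere (0 : EuclideanSpace ℝ (Fin n)) 1) =>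
        ∑ j, fderiv ℝ (X j) (r • x.1) (EuclideanSpace.single j 1))
      (continuousOn_finsetSum _ fun j _ => (hfd j).clm_apply (by fun_prop))
  have ha0 : ∫ x : sphere (0 : EuclideanSpace ℝ (Fin n)) 1, ∑ j, x.1 j * X j ((0 : ℝ) • x.1)
        ∂unitSphereMeasure n = 0 := by
    have h := integral_unitSphere_comp (LinearIsometryEquiv.neg ℝ)
      (fun x : sphere (0 : EuclideanSpace ℝ (Fin n)) 1 => ∑ j, x.1 j * X j ((0 : ℝ) • x.1))
    simp only [LinearIsometryEquiv.coe_unitSphere, LinearIsometryEquiv.coe_neg, PiLp.neg_apply,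
      zero_smul, neg_mul, Finset.sum_neg_distrib, integral_neg] at h ⊢
    linarith
  rw [intervalIntegral.integral_eq_sub_of_hasDerivAt_of_le (f := fun r => r ^ (n - 1) *
    ∫ x : sphere (0 : EuclideanSpace ℝ (Fin n)) 1,
        ∑ j, x.1 j * X j (r • x.1) ∂unitSphereMeasure n) hρ.le]
  · rw [ha0, mul_zero, sub_zero]
  · exact (continuousOn_pow _).mul fun t ht =>
      (hda t (hU ht)).continuousAt.continuousWithinAt
  · intro t ht
    have hdiv := integral_unitSphere_divergence hX ht.1 (ht.2.trans hρR)
    obtain ⟨m, rfl⟩ := Nat.exists_eq_succ_of_ne_zero hn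
    refine ((hasDerivAt_pow m t).mul (hda t (hU (Ioo_subset_Icc_self ht)))).congr_deriv ?_
    simp only [Nat.succ_eq_add_one, Nat.add_sub_cancel, Nat.cast_add, Nat.cast_one] at hdiv ⊢
    have hpow : (m : ℝ) * t ^ (m - 1) * t = m * t ^ m := by
      cases m with
      | zero => simp
      | succ k => simp [pow_succ]; ring
    refine mul_right_cancel₀ ht.1.ne' ?_
    linear_combination (∫ x : sphere (0 : EuclideanSpace ℝ (Fin (m + 1))) 1,
        ∑ j, x.1 j * X j (t • x.1) ∂unitSphereMeasure (m + 1))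
      * hpow - t ^ m * hdiv
  · refine ContinuousOn.intervalIntegrable ?_
    rw [uIcc_of_le hρ.le]
    exact (continuousOn_pow _).mul (hb.mono hU)

theorem sq_integral_mul_le_of_compactSpace {α : Type*} [TopologicalSpace α] [CompactSpace α]
    [MeasurableSpace α] [OpensMeasurableSpace α] (μ : Measure α) [IsFiniteMeasure μ]
    {p q : α → ℝ} (hp : Continuous p) (hq : Continuous q) :
    (∫ x, p x * q x ∂μ) ^ 2 ≤ (∫ x, p x ^ 2 ∂μ) * ∫ x, q x ^ 2 ∂μ := by
  have ipp : Integrable (fun x => p x ^ 2) μ := (hp.pow 2).integrable_of_compactSpace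
  have iqq : Integrable (fun x => q x ^ 2) μ := (hq.pow 2).integrable_of_compactSpace
  have ipq : Integrable (fun x => p x * q x) μ := (hp.mul hq).integrable_of_compactSpace
  have h : ∀ t : ℝ, 0 ≤ (∫ x, q x ^ 2 ∂μ) * (t * t) + (2 * ∫ x, p x * q x ∂μ) * t
      + ∫ x, p x ^ 2 ∂μ := by
    intro t
    have h0 : 0 ≤ ∫ x, (q x ^ 2 * (t * t) + p x * q x * (2 * t) + p x ^ 2) ∂μ :=
      integral_nonneg fun x => by
        have := sq_nonneg (t * q x + p x)
        simp only [Pi.zero_apply]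
        linarith
    have i12 : Integrable (fun x => q x ^ 2 * (t * t) + p x * q x * (2 * t)) μ :=
      (iqq.mul_const _).add (ipq.mul_const _)
    rw [integral_add i12 ipp, integral_add (iqq.mul_const _) (ipq.mul_const _), integral_mul_const,
      integral_mul_const] at h0
    linarith
  have := discrim_le_zero h
  rw [discrim] at this
  linarith

/-- The logarithmic derivative of a midpoint log-convex function is monotone. -/
theorem monotoneOn_deriv_div_of_sq_midpoint_le {h h' : ℝ → ℝ} (h0 : ∀ x < 0, 0 ≤ h x)
    (hd : ∀ x < 0, HasDerivAt h (h' x) x)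
    (hm : ∀ x < 0, ∀ y < 0, h ((x + y) / 2) ^ 2 ≤ h x * h y) :
    MonotoneOn (fun x => h' x / h x) (Iio 0) := by
  by_cases hz : ∃ x < 0, h x = 0
  · obtain ⟨x, hx, hx0⟩ := hz
    have step : ∀ k : ℕ, ∀ c < x / 2 ^ k, h c = 0 ∨ k = 0 := by
      intro k
      induction k with
      | zero => exact fun c _ => Or.inr rfl
      | succ k ih =>
        intro c hc
        left
        obtain ⟨z, hz, hzc, hz0⟩ : ∃ z, h z = 0 ∧ 2 * c - z < 0 ∧ z < 0 := by
          rcases Nat.eq_zero_or_pos k with rfl | hk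
          · exact ⟨x, hx0, by norm_num at hc; linarith, hx⟩
          · have hc' : 2 * c < x / 2 ^ k := by
              rw [pow_succ, ← div_div] at hc
              linarith
            have hneg : x / 2 ^ k < 0 := div_neg_of_neg_of_pos hx (by positivity)
            refine ⟨(2 * c + x / 2 ^ k) / 2, ?_, by linarith, by linarith⟩
            exact (ih _ (by linarith)).resolve_right hk.ne'
        have := hm z hz0 (2 * c - z) hzc
        rw [hz, zero_mul, show (z + (2 * c - z)) / 2 = c by ring] at this
        exact pow_eq_zero_iff two_ne_zero |>.1 (le_antisymm this (sq_nonneg _))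
    have hall : ∀ y < 0, h y = 0 := by
      intro y hy
      obtain ⟨k, hk⟩ := pow_unbounded_of_one_lt (x / y) (one_lt_two)
      refine (step (k + 1) y ?_).resolve_right k.succ_ne_zero
      rw [div_lt_iff_of_neg hy] at hk
      rw [lt_div_iff₀ (by positivity), pow_succ]
      have : (0 : ℝ) < 2 ^ k := by positivity
      nlinarith
    intro a ha b hb _
    simp [hall a ha, hall b hb]
  push Not at hz
  have hpos : ∀ x < 0, 0 < h x := fun x hx => lt_of_le_of_ne (h0 x hx) (hz x hx).symm
  set φ : ℝ → ℝ := fun x => Real.log (h x) with hφ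
  have hφd : ∀ x < 0, HasDerivAt φ (h' x / h x) x := fun x hx => (hd x hx).log (hz x hx)
  have hφm : ∀ z δ : ℝ, z < 0 → z + 2 * δ < 0 → φ (z + δ) - φ z ≤ φ (z + 2 * δ) - φ (z + δ) := by
    intro z δ hz1 hz2
    have h1 := hm z hz1 (z + 2 * δ) hz2
    rw [show (z + (z + 2 * δ)) / 2 = z + δ by ring] at h1
    have h2 := Real.log_le_log (pow_pos (hpos (z + δ) (by linarith)) 2) h1
    rw [Real.log_pow, Real.log_mul (hz _ hz1) (hz _ hz2)] at h2
    push_cast at h2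
    simp only [hφ]
    linarith
  have hiter : ∀ z δ : ℝ, 0 < δ → ∀ k : ℕ, z + (k + 1) * δ < 0 →
      φ (z + δ) - φ z ≤ φ (z + (k + 1) * δ) - φ (z + k * δ) := by
    intro z δ hδ k
    induction k with
    | zero => intro _; simp
    | succ k ih =>
      intro hk
      push_cast at hk ⊢
      have h1 : z + (k + 1) * δ < 0 := by nlinarith
      have h2 := hφm (z + k * δ) δ (by nlinarith) (by linarith)
      rw [show z + k * δ + δ = z + (k + 1) * δ by ring,
        show z + k * δ + 2 * δ = z + (k + 1 + 1) * δ by ring] at h2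
      exact (ih h1).trans h2
  intro x hx y hy hxy
  rcases hxy.eq_or_lt with rfl | hlt
  · exact le_rfl
  have hseq : Filter.Tendsto (fun k : ℕ => (y - x) / (k + 1)) Filter.atTop (𝓝[>] 0) := by
    refine tendsto_nhdsWithin_iff.2 ⟨?_, Filter.Eventually.of_forall fun k =>
      div_pos (sub_pos.2 hlt) (by positivity)⟩
    simpa [div_eq_mul_inv] using
      (tendsto_one_div_add_atTop_nhds_zero_nat (𝕜 := ℝ)).const_mul (y - x)
  refine le_of_tendsto_of_tendsto (((hφd x hx).tendsto_slope_zero_right).comp hseq)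
    (((hφd y hy).tendsto_slope_zero_right).comp hseq) ?_
  have hev : ∀ᶠ k : ℕ in Filter.atTop, (y - x) / (k + 1) < -y :=
    (tendsto_nhdsWithin_iff.1 hseq).1.eventually (gt_mem_nhds (neg_pos.2 hy))
  filter_upwards [hev] with k hk
  have hk1 : (0 : ℝ) < k + 1 := by positivity
  have hδ : 0 < (y - x) / (k + 1) := div_pos (sub_pos.2 hlt) hk1
  have hyx : x + (k + 1) * ((y - x) / (k + 1)) = y := by
    field_simp
    ring
  have := hiter x _ hδ (k + 1) (by push_cast; linarith)
  push_cast at this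
  rw [add_mul (k + 1 : ℝ) 1, ← add_assoc, hyx, one_mul] at this
  exact mul_le_mul_of_nonneg_left this (inv_nonneg.2 hδ.le)

theorem HarmonicOnBall.pow_mul_integral_mul_fderiv_eq {n : ℕ} (hn : n ≠ 0)
    {v w : EuclideanSpace ℝ (Fin n) → ℝ} {R ρ : ℝ} (hv : ContDiffOn ℝ 1 v (ball 0 R))
    (hw : HarmonicOnBall w R) (hρ : 0 < ρ) (hρR : ρ < R) :
    ρ ^ (n - 1) * ∫ x : sphere (0 : EuclideanSpace ℝ (Fin n)) 1,
        v (ρ • x.1) * fderiv ℝ w (ρ • x.1) x.1 ∂unitSphereMeasure n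
      = ∫ r in (0 : ℝ)..ρ, r ^ (n - 1) * ∫ x : sphere (0 : EuclideanSpace ℝ (Fin n)) 1,
        ∑ j, fderiv ℝ v (r • x.1) (EuclideanSpace.single j 1)
          * fderiv ℝ w (r • x.1) (EuclideanSpace.single j 1) ∂unitSphereMeasure n := by
  have hdw : ∀ j, ContDiffOn ℝ 1 (fun y => fderiv ℝ w y (EuclideanSpace.single j 1))
      (ball 0 R) := fun j =>
    (hw.1.fderiv_of_isOpen isOpen_ball (by norm_num)).clm_apply contDiffOn_const
  refine Eq.trans ?_ ((pow_mul_integral_unitSphere_eq hn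
    (fun j => hv.mul (hdw j)) hρ hρR).trans ?_)
  · congr 2
    ext x
    rw [EuclideanSpace.clm_apply_eq_sum (fderiv ℝ w (ρ • x.1)) x.1, Finset.mul_sum]
    exact Finset.sum_congr rfl fun j _ => by ring
  · refine intervalIntegral.integral_congr fun r hr => ?_
    rw [uIcc_of_le hρ.le] at hr
    refine congrArg (r ^ (n - 1) * ·) (integral_congr_ae (ae_of_all _ fun x => ?_))
    have hx : r • x.1 ∈ ball (0 : EuclideanSpace ℝ (Fin n)) R :=
      smul_unitSphere_mem_ball (by rw [abs_of_nonneg hr.1]; linarith [hr.2]) x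
    have hlap := hw.2 _ hx
    rw [lap] at hlap
    have hj : ∀ j, fderiv ℝ (fun y => v y * fderiv ℝ w y (EuclideanSpace.single j 1)) (r • x.1)
        (EuclideanSpace.single j 1)
        = v (r • x.1) * fderiv ℝ (fun y => fderiv ℝ w y (EuclideanSpace.single j 1)) (r • x.1)
            (EuclideanSpace.single j 1)
          + fderiv ℝ v (r • x.1) (EuclideanSpace.single j 1)
            * fderiv ℝ w (r • x.1) (EuclideanSpace.single j 1) := by
      intro j
      rw [fderiv_fun_mul
        ((hv.contDiffAt (isOpen_ball.mem_nhds hx)).differentiableAt one_ne_zero)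
        (((hdw j).contDiffAt (isOpen_ball.mem_nhds hx)).differentiableAt one_ne_zero)]
      simp [mul_comm]
    simp only [hj, Finset.sum_add_distrib, ← Finset.mul_sum, hlap, mul_zero, zero_add]

/-- Green's second identity for harmonic functions on the unit ball. -/
theorem HarmonicOnBall.integral_mul_fderiv_comm {n : ℕ} (hn : n ≠ 0)
    {v w : EuclideanSpace ℝ (Fin n) → ℝ} {R : ℝ} (hv : HarmonicOnBall v R)
    (hw : HarmonicOnBall w R) (hR : 1 < R) :
    ∫ x : sphere (0 : EuclideanSpace ℝ (Fin n)) 1, v x.1 * fderiv ℝ w x.1 x.1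
        ∂unitSphereMeasure n
      = ∫ x : sphere (0 : EuclideanSpace ℝ (Fin n)) 1, w x.1 * fderiv ℝ v x.1 x.1
        ∂unitSphereMeasure n := by
  have h1 := hw.pow_mul_integral_mul_fderiv_eq hn (hv.1.of_le one_le_two) one_pos hR
  have h2 := hv.pow_mul_integral_mul_fderiv_eq hn (hw.1.of_le one_le_two) one_pos hR
  simp only [one_pow, one_mul, one_smul] at h1 h2
  rw [h1, h2]
  simp only [mul_comm]

theorem HarmonicOnBall.comp_smul {n : ℕ} {u : EuclideanSpace ℝ (Fin n) → ℝ} {R R' c : ℝ}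
    (hu : HarmonicOnBall u R) (hc : 0 < c) (h : c * R' ≤ R) :
    HarmonicOnBall (fun x => u (c • x)) R' := by
  have hm : MapsTo (fun x : EuclideanSpace ℝ (Fin n) => c • x) (ball 0 R') (ball 0 R) := by
    intro x hx
    rw [mem_ball_zero_iff] at hx ⊢
    rw [norm_smul, Real.norm_of_nonneg hc.le]
    exact (mul_lt_mul_of_pos_left hx hc).trans_le h
  refine ⟨hu.1.comp (contDiff_const_smul c).contDiffOn hm, fun x hx => ?_⟩
  have hux := hu.2 _ (hm hx)
  have hd : ∀ i, DifferentiableAt ℝ (fun y => fderiv ℝ u (c • y) (EuclideanSpace.single i 1)) x := by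
    intro i
    have hdi := (hu.1.fderiv_of_isOpen isOpen_ball (m := 1) (by norm_num)).clm_apply
      (contDiffOn_const (c := EuclideanSpace.single i (1 : ℝ)))
    exact ((hdi.comp (contDiff_const_smul c).contDiffOn hm).contDiffAt
      (isOpen_ball.mem_nhds hx)).differentiableAt one_ne_zero
  rw [lap] at hux ⊢
  rw [← mul_zero (c * c), ← hux, Finset.mul_sum]
  refine Finset.sum_congr rfl fun i _ => ?_
  simp only [fderiv_comp_smul, _root_.smul_apply, smul_eq_mul]
  rw [fderiv_const_mul (hd i),
    fderiv_comp_smul (f := fun y => fderiv ℝ u y (EuclideanSpace.single i 1)) c]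
  simp [mul_assoc]

theorem HarmonicOnBall.mul_integral_mul_fderiv_comm {n : ℕ} (hn : n ≠ 0)
    {u : EuclideanSpace ℝ (Fin n) → ℝ} {r s : ℝ} (hu : HarmonicOnBall u 1)
    (hr : r ∈ Ioo (0 : ℝ) 1) (hs : s ∈ Ioo (0 : ℝ) 1) :
    s * ∫ x : sphere (0 : EuclideanSpace ℝ (Fin n)) 1,
        u (r • x.1) * fderiv ℝ u (s • x.1) x.1 ∂unitSphereMeasure n
      = r * ∫ x : sphere (0 : EuclideanSpace ℝ (Fin n)) 1,
        u (s • x.1) * fderiv ℝ u (r • x.1) x.1 ∂unitSphereMeasure n := by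
  have hmax : 0 < max r s := lt_max_of_lt_left hr.1
  have hle : ∀ t ≤ max r s, t * (max r s)⁻¹ ≤ 1 := fun t ht => by
    rwa [← div_eq_mul_inv, div_le_one hmax]
  have h := (hu.comp_smul hr.1 (hle r (le_max_left r s))).integral_mul_fderiv_comm hn
    (hu.comp_smul hs.1 (hle s (le_max_right r s)))
    ((one_lt_inv₀ hmax).2 (max_lt hr.2 hs.2))
  simp only [fderiv_comp_smul, _root_.smul_apply, smul_eq_mul,
    mul_left_comm _ r, mul_left_comm _ s, integral_const_mul] at h
  exact h

theorem ContDiffOn.hasDerivAt_comp_exp_smul {n : ℕ} {u : EuclideanSpace ℝ (Fin n) → ℝ}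
    {a : ℝ → ℝ} {a' t : ℝ} (hu : ContDiffOn ℝ 1 u (ball 0 1)) (ha : HasDerivAt a a' t)
    (hat : a t < 0) (x : sphere (0 : EuclideanSpace ℝ (Fin n)) 1) :
    HasDerivAt (fun t => u (Real.exp (a t) • x.1))
      (a' * (Real.exp (a t) * fderiv ℝ u (Real.exp (a t) • x.1) x.1)) t :=
  (HasDerivAt.comp (h₂ := fun s => u (s • x.1)) t
    (hu.hasDerivAt_comp_smul (by simpa using hat) x) ha.exp).congr_deriv (by ring)

theorem ContinuousOn.comp_exp_smul_unitSphere {n : ℕ} {F : Type*} [TopologicalSpace F]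
    {f : EuclideanSpace ℝ (Fin n) → F} {a : ℝ → ℝ} {U : Set ℝ}
    (hf : ContinuousOn f (ball 0 1)) (ha : Continuous a) (haU : ∀ t ∈ U, a t < 0) :
    ContinuousOn (fun p : ℝ × sphere (0 : EuclideanSpace ℝ (Fin n)) 1 =>
      f (Real.exp (a p.1) • p.2.1)) (U ×ˢ univ) :=
  hf.comp (by fun_prop) fun p hp => smul_unitSphere_mem_ball (by simpa using haU _ hp.1) p.2

theorem HarmonicOnBall.integral_exp_mul_integral_exp_eq {n : ℕ} (hn : n ≠ 0)
    {u : EuclideanSpace ℝ (Fin n) → ℝ} (hu : HarmonicOnBall u 1) {m t : ℝ}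
    (ht : t ∈ Ioo m (-m)) :
    ∫ x : sphere (0 : EuclideanSpace ℝ (Fin n)) 1,
        u (Real.exp (m + t) • x.1) * u (Real.exp (m - t) • x.1) ∂unitSphereMeasure n
      = ∫ x : sphere (0 : EuclideanSpace ℝ (Fin n)) 1,
        u (Real.exp m • x.1) ^ 2 ∂unitSphereMeasure n := by
  have hm : m < 0 := by linarith [ht.1, ht.2]
  have hu1 := hu.1.of_le one_le_two
  have hfd := hu1.continuousOn_fderiv_of_isOpen isOpen_ball le_rfl
  have hp : ∀ t ∈ Ioo m (-m), m + t < 0 := fun t ht => by linarith [ht.2]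
  have hq : ∀ t ∈ Ioo m (-m), m - t < 0 := fun t ht => by linarith [ht.1]
  have hd : ∀ t ∈ Ioo m (-m), HasDerivAt (fun t =>
      ∫ x : sphere (0 : EuclideanSpace ℝ (Fin n)) 1,
        u (Real.exp (m + t) • x.1) * u (Real.exp (m - t) • x.1) ∂unitSphereMeasure n) 0 t := by
    intro t ht
    have hcp := hu1.continuousOn.comp_exp_smul_unitSphere (a := fun t => m + t) (by fun_prop) hp
    have hcq := hu1.continuousOn.comp_exp_smul_unitSphere (a := fun t => m - t) (by fun_prop) hq
    have hdp := hfd.comp_exp_smul_unitSphere (a := fun t => m + t) (by fun_prop) hp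
    have hdq := hfd.comp_exp_smul_unitSphere (a := fun t => m - t) (by fun_prop) hq
    have hslice : ∀ {g : ℝ × sphere (0 : EuclideanSpace ℝ (Fin n)) 1 → ℝ},
        ContinuousOn g (Ioo m (-m) ×ˢ univ) → ∀ s ∈ Ioo m (-m), Continuous fun x => g (s, x) :=
      fun hg s hs => hg.comp_continuous (by fun_prop) fun x => ⟨hs, mem_univ x⟩
    have hA : ContinuousOn (fun p : ℝ × sphere (0 : EuclideanSpace ℝ (Fin n)) 1 =>
        u (Real.exp (m - p.1) • p.2.1) * fderiv ℝ u (Real.exp (m + p.1) • p.2.1) p.2.1)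
        (Ioo m (-m) ×ˢ univ) := hcq.mul (hdp.clm_apply (by fun_prop))
    have hB : ContinuousOn (fun p : ℝ × sphere (0 : EuclideanSpace ℝ (Fin n)) 1 =>
        u (Real.exp (m + p.1) • p.2.1) * fderiv ℝ u (Real.exp (m - p.1) • p.2.1) p.2.1)
        (Ioo m (-m) ×ˢ univ) := hcp.mul (hdq.clm_apply (by fun_prop))
    refine (hasDerivAt_integral_of_continuousOn_deriv (unitSphereMeasure n) (U := Ioo m (-m))
      (F := fun t (x : sphere (0 : EuclideanSpace ℝ (Fin n)) 1) =>
        u (Real.exp (m + t) • x.1) * u (Real.exp (m - t) • x.1))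
      (F' := fun t (x : sphere (0 : EuclideanSpace ℝ (Fin n)) 1) =>
        Real.exp (m + t) * (u (Real.exp (m - t) • x.1) * fderiv ℝ u (Real.exp (m + t) • x.1) x.1)
        - Real.exp (m - t)
          * (u (Real.exp (m + t) • x.1) * fderiv ℝ u (Real.exp (m - t) • x.1) x.1))
      isOpen_Ioo (hslice (hcp.mul hcq)) ?_ ?_ ht).congr_deriv ?_
    · intro s hs x
      exact ((hu1.hasDerivAt_comp_exp_smul ((hasDerivAt_id s).const_add m) (hp s hs) x).mul
        (hu1.hasDerivAt_comp_exp_smul ((hasDerivAt_id s).const_sub m) (hq s hs) x)).congr_deriv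
        (by simp only [id]; ring)
    · exact (ContinuousOn.mul (by fun_prop) hA).sub (ContinuousOn.mul (by fun_prop) hB)
    · rw [integral_sub ((hslice hA t ht).integrable_of_compactSpace.const_mul _)
        ((hslice hB t ht).integrable_of_compactSpace.const_mul _), integral_const_mul,
        integral_const_mul, hu.mul_integral_mul_fderiv_comm hn
          ⟨Real.exp_pos _, Real.exp_lt_one_iff.2 (hq t ht)⟩
          ⟨Real.exp_pos _, Real.exp_lt_one_iff.2 (hp t ht)⟩,
        sub_self]
  have h0 : (0 : ℝ) ∈ Ioo m (-m) := ⟨hm, neg_pos.2 hm⟩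
  have := isOpen_Ioo.is_const_of_deriv_eq_zero isPreconnected_Ioo
    (fun t ht => (hd t ht).differentiableAt.differentiableWithinAt) (fun t ht => (hd t ht).deriv)
    ht h0
  simpa [sq] using this

theorem HarmonicOnBall.sq_integral_midpoint_le {n : ℕ} (hn : n ≠ 0)
    {u : EuclideanSpace ℝ (Fin n) → ℝ} (hu : HarmonicOnBall u 1) {a b : ℝ}
    (ha : a < 0) (hb : b < 0) :
    (∫ x : sphere (0 : EuclideanSpace ℝ (Fin n)) 1,
        u (Real.exp ((a + b) / 2) • x.1) ^ 2 ∂unitSphereMeasure n) ^ 2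
      ≤ (∫ x : sphere (0 : EuclideanSpace ℝ (Fin n)) 1,
          u (Real.exp a • x.1) ^ 2 ∂unitSphereMeasure n)
        * ∫ x : sphere (0 : EuclideanSpace ℝ (Fin n)) 1,
          u (Real.exp b • x.1) ^ 2 ∂unitSphereMeasure n := by
  rw [← hu.integral_exp_mul_integral_exp_eq hn (m := (a + b) / 2) (t := (a - b) / 2)
      ⟨by linarith, by linarith⟩, show (a + b) / 2 + (a - b) / 2 = a by ring,
    show (a + b) / 2 - (a - b) / 2 = b by ring]
  exact sq_integral_mul_le_of_compactSpace _
    (hu.1.continuousOn.continuous_comp_smul_unitSphere (by simpa using ha))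
    (hu.1.continuousOn.continuous_comp_smul_unitSphere (by simpa using hb))

theorem HarmonicOnBall.monotoneOn_integral_exp_logDeriv {n : ℕ} (hn : n ≠ 0)
    {u : EuclideanSpace ℝ (Fin n) → ℝ} (hu : HarmonicOnBall u 1) :
    MonotoneOn (fun a =>
      (2 * (Real.exp a * ∫ x : sphere (0 : EuclideanSpace ℝ (Fin n)) 1,
        u (Real.exp a • x.1) * fderiv ℝ u (Real.exp a • x.1) x.1 ∂unitSphereMeasure n))
      / ∫ x : sphere (0 : EuclideanSpace ℝ (Fin n)) 1,
        u (Real.exp a • x.1) ^ 2 ∂unitSphereMeasure n) (Iio 0) := by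
  have hu1 := hu.1.of_le one_le_two
  refine monotoneOn_deriv_div_of_sq_midpoint_le (fun a _ => integral_nonneg fun x => sq_nonneg _)
    (fun a ha => ?_) fun a ha b hb => hu.sq_integral_midpoint_le hn ha hb
  have hc := hu1.continuousOn.comp_exp_smul_unitSphere (a := fun t => t) (U := Iio 0)
    (by fun_prop) fun t ht => ht
  have hd := (hu1.continuousOn_fderiv_of_isOpen isOpen_ball le_rfl).comp_exp_smul_unitSphere
    (a := fun t => t) (U := Iio 0) (by fun_prop) fun t ht => ht
  refine (hasDerivAt_integral_of_continuousOn_deriv (unitSphereMeasure n) (U := Iio 0)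
    (F := fun t (x : sphere (0 : EuclideanSpace ℝ (Fin n)) 1) => u (Real.exp t • x.1) ^ 2)
    (F' := fun t (x : sphere (0 : EuclideanSpace ℝ (Fin n)) 1) =>
      2 * (Real.exp t * (u (Real.exp t • x.1) * fderiv ℝ u (Real.exp t • x.1) x.1)))
    isOpen_Iio (fun t ht => ?_) (fun t ht x => ?_) ?_ ha).congr_deriv ?_
  · exact (hu1.continuousOn.continuous_comp_smul_unitSphere (by simpa using ht)).pow 2
  · exact ((hu1.hasDerivAt_comp_exp_smul (hasDerivAt_id t) ht x).pow 2).congr_deriv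
      (by simp only [id]; ring)
  · exact ContinuousOn.mul (by fun_prop) (ContinuousOn.mul (by fun_prop)
      (hc.mul (hd.clm_apply (by fun_prop))))
  · simp only [integral_const_mul]

theorem norm_gradient_sq_eq_sum {n : ℕ} (u : EuclideanSpace ℝ (Fin n) → ℝ)
    (x : EuclideanSpace ℝ (Fin n)) :
    ‖gradient u x‖ ^ 2 = ∑ j, fderiv ℝ u x (EuclideanSpace.single j 1) ^ 2 := by
  rw [EuclideanSpace.real_norm_sq_eq]
  refine Finset.sum_congr rfl fun j _ => ?_
  rw [← toDual_gradient, InnerProductSpace.toDual_apply_apply, EuclideanSpace.inner_single_right]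
  simp

theorem HarmonicOnBall.dirD_eq {n : ℕ} (hn : n ≠ 0) {u : EuclideanSpace ℝ (Fin n) → ℝ}
    (hu : HarmonicOnBall u 1) {r : ℝ} (hr : r ∈ Ioo (0 : ℝ) 1) :
    dirD u r = r ^ (n - 1) * ∫ x : sphere (0 : EuclideanSpace ℝ (Fin n)) 1,
      u (r • x.1) * fderiv ℝ u (r • x.1) x.1 ∂unitSphereMeasure n := by
  have : NeZero n := ⟨hn⟩
  have hu1 := hu.1.of_le one_le_two
  have hcont : ContinuousOn (fun x => ‖gradient u x‖ ^ 2) (closedBall 0 r) := by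
    simp only [norm_gradient_sq_eq_sum]
    exact continuousOn_finsetSum _ fun j _ =>
      (((hu1.continuousOn_fderiv_of_isOpen isOpen_ball le_rfl).mono
        (closedBall_subset_ball hr.2)).clm_apply continuousOn_const).pow 2
  rw [dirD, setIntegral_ball_eq_intervalIntegral_unitSphere volume hr.1.le
    ((hcont.integrableOn_compact (isCompact_closedBall 0 r)).mono_set ball_subset_closedBall),
    hu.pow_mul_integral_mul_fderiv_eq hn hu1 hr.1 hr.2, finrank_euclideanSpace_fin]
  simp only [norm_gradient_sq_eq_sum, ← sq]

theorem exists_sphH_eq {n : ℕ} (hn : n ≠ 0) : ∃ c : ℝ, 0 ≤ c ∧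
    ∀ (u : EuclideanSpace ℝ (Fin n) → ℝ) (R : ℝ), ContinuousOn u (ball 0 R) → ∀ r ∈ Ioo 0 R,
      sphH n u r = r ^ (n - 1) * (c * ∫ x : sphere (0 : EuclideanSpace ℝ (Fin n)) 1,
        u (r • x.1) ^ 2 ∂unitSphereMeasure n) := by
  have hn1 : 1 ≤ n := Nat.one_le_iff_ne_zero.2 hn
  have hd : (0 : ℝ) ≤ (n : ℝ) - 1 := by
    rw [sub_nonneg]
    exact_mod_cast hn1
  have : NeZero n := ⟨hn⟩
  obtain ⟨c, hc, h⟩ := exists_integral_eq_mul_integral_of_transitive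
    (μH[(n : ℝ) - 1] : Measure (sphere (0 : EuclideanSpace ℝ (Fin n)) 1)) (unitSphereMeasure n)
    fun x y => by
      obtain ⟨g, hg⟩ := exists_unitSphere_apply_eq x y
      exact ⟨g.unitSphere, hg, g.unitSphere.map_hausdorffMeasure _, map_unitSphere_toSphere g⟩
  refine ⟨c, hc, fun u R hu r hr => ?_⟩
  rw [sphH, setIntegral_sphere_hausdorffMeasure hd hr.1, ← Nat.cast_pred hn1, Real.rpow_natCast,
    Nat.cast_pred hn1]
  have hrR : |r| < R := by simpa only [abs_of_pos hr.1] using hr.2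
  rw [h (fun x => u (r • x.1) ^ 2) ((hu.continuous_comp_smul_unitSphere hrR).pow 2) fun x => sq_nonneg _]

theorem freqN_zero (u : EuclideanSpace ℝ (Fin 0) → ℝ) {r : ℝ} (hr : 0 < r) : freqN 0 u r = 0 := by
  have : sphere (0 : EuclideanSpace ℝ (Fin 0)) r = ∅ := sphere_eq_empty_of_subsingleton hr.ne'
  simp [freqN, sphH, this]

/-- **Almgren's monotonicity of the frequency.**
If `u` is a harmonic function in the unit ball `B₁ ⊂ ℝⁿ`, not identically zero, then
the frequency `N(r) = r D(r)/H(r)` is nondecreasing on `(0,1)`. -/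
theorem frequency_monotone (n : ℕ) (u : EuclideanSpace ℝ (Fin n) → ℝ)
    (hu : HarmonicOnBall u 1)
    (hne : ∃ x ∈ ball (0 : EuclideanSpace ℝ (Fin n)) 1, u x ≠ 0) :
    MonotoneOn (freqN n u) (Ioo (0 : ℝ) 1) := by
  rcases eq_or_ne n 0 with rfl | hn
  · intro r hr s hs _
    rw [freqN_zero u hr.1, freqN_zero u hs.1]
  obtain ⟨c, hc, hH⟩ := exists_sphH_eq hn
  have hlog : MonotoneOn Real.log (Ioo 0 1) := fun r hr s _ hrs => Real.log_le_log hr.1 hrs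
  have hmono := (monotone_mul_left_of_nonneg (a := (2 * c)⁻¹) (by positivity)).comp_monotoneOn
    ((hu.monotoneOn_integral_exp_logDeriv hn).comp hlog fun r hr => Real.log_neg hr.1 hr.2)
  refine hmono.congr fun r hr => ?_
  have hpow : r ^ (n - 1) ≠ 0 := pow_ne_zero _ hr.1.ne'
  simp only [Function.comp_apply, Real.exp_log hr.1]
  rw [freqN, hu.dirD_eq hn hr, hH u 1 hu.1.continuousOn r hr, mul_left_comm r,
    mul_div_mul_left _ _ hpow, inv_mul_eq_div, div_div, mul_comm _ (2 * c), mul_assoc 2 c,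
    mul_div_mul_left _ _ two_ne_zero]
end
end

section
/- Let Ω ⊂ ℝⁿ be a bounded domain with C² boundary and let δ > 0 be such that (y,t) ↦ y + tν(y) is one-to-one from ∂Ω × (−δ,δ) onto the δ-neighborhood of ∂Ω. Then for any ρ < δ and any Steklov eigenfunction u (with any eigenvalue λ > 0), there exists a point y* ∈ ∂Ω such that ∫_Ω u² ≤ C ρ^{−2n+1} ∫_{B(y*,ρ) ∩ Ω} u², where the constant C depends only on Ω. -/
open MeasureTheory Metric Set
open scoped ENNReal

noncomputable section

/-- `Ω ⊆ ℝⁿ` is a bounded domain with `C²` boundary, described by the `C²` defining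
function `F` (negative exactly on `Ω`, vanishing exactly on `∂Ω`, with nonvanishing
gradient on `∂Ω`). -/
structure C2Domain (n : ℕ) (Ω : Set (EuclideanSpace ℝ (Fin n)))
    (F : EuclideanSpace ℝ (Fin n) → ℝ) : Prop where
  isOpen : IsOpen Ω
  bounded : Bornology.IsBounded Ω
  connected : IsConnected Ω
  smooth : ContDiff ℝ 2 F
  eq_sublevel : Ω = {x | F x < 0}
  eq_frontier : frontier Ω = {x | F x = 0}
  grad_ne : ∀ x ∈ frontier Ω, gradient F x ≠ 0

/-- The outward unit normal on `∂Ω` induced by the defining function `F`. -/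
def normalOf {n : ℕ} (F : EuclideanSpace ℝ (Fin n) → ℝ) (x : EuclideanSpace ℝ (Fin n)) :
    EuclideanSpace ℝ (Fin n) :=
  ‖gradient F x‖⁻¹ • gradient F x

/-- `u` is a (nonzero, classical) Steklov eigenfunction on `Ω` with eigenvalue `lam`:
`u` is harmonic in `Ω`, `C¹` up to the boundary, and `∂u/∂ν = lam·u` on `∂Ω`. -/
def IsSteklov {n : ℕ} (Ω : Set (EuclideanSpace ℝ (Fin n)))
    (ν : EuclideanSpace ℝ (Fin n) → EuclideanSpace ℝ (Fin n)) (lam : ℝ)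
    (u : EuclideanSpace ℝ (Fin n) → ℝ) : Prop :=
  ContDiffOn ℝ 2 u Ω ∧ ContDiffOn ℝ 1 u (closure Ω) ∧
  (∀ x ∈ Ω, lap u x = 0) ∧
  (∀ x ∈ frontier Ω, fderivWithin ℝ u (closure Ω) x (ν x) = lam * u x) ∧
  (∃ x ∈ Ω, u x ≠ 0)

/-- The squared Euclidean length of the gradient of `w`, in coordinates. -/
def gradSq {n : ℕ} (w : EuclideanSpace ℝ (Fin n) → ℝ) (x : EuclideanSpace ℝ (Fin n)) : ℝ :=
  ∑ i : Fin n, (fderiv ℝ w x (EuclideanSpace.single i 1)) ^ 2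

section Laplacian

variable {n : ℕ}

lemma contDiffAt_fderiv_apply {w : EuclideanSpace ℝ (Fin n) → ℝ}
    {x : EuclideanSpace ℝ (Fin n)} (hw : ContDiffAt ℝ 2 w x) (v : EuclideanSpace ℝ (Fin n)) :
    ContDiffAt ℝ 1 (fun y => fderiv ℝ w y v) x :=
  (hw.fderiv_right (m := 1) (by norm_num)).clm_apply contDiffAt_const

lemma contDiff_fderiv_apply {w : EuclideanSpace ℝ (Fin n) → ℝ} (hw : ContDiff ℝ 2 w)
    (v : EuclideanSpace ℝ (Fin n)) : ContDiff ℝ 1 (fun y => fderiv ℝ w y v) :=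
  contDiff_iff_contDiffAt.2 fun _ => contDiffAt_fderiv_apply hw.contDiffAt v

lemma continuous_lap {w : EuclideanSpace ℝ (Fin n) → ℝ} (hw : ContDiff ℝ 2 w) :
    Continuous (lap w) :=
  continuous_finsetSum _ fun i _ =>
    ((contDiff_fderiv_apply hw (EuclideanSpace.single i 1)).continuous_fderiv (by norm_num)).clm_apply
      continuous_const

lemma continuous_gradSq {w : EuclideanSpace ℝ (Fin n) → ℝ} (hw : ContDiff ℝ 2 w) :
    Continuous (gradSq w) :=
  continuous_finsetSum _ fun i _ =>
    ((contDiff_fderiv_apply hw (EuclideanSpace.single i 1)).continuous).pow 2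

lemma gradSq_nonneg (w : EuclideanSpace ℝ (Fin n) → ℝ) (x : EuclideanSpace ℝ (Fin n)) :
    0 ≤ gradSq w x :=
  Finset.sum_nonneg fun _ _ => sq_nonneg _

lemma lap_congr {w₁ w₂ : EuclideanSpace ℝ (Fin n) → ℝ} {x : EuclideanSpace ℝ (Fin n)}
    (h : w₁ =ᶠ[nhds x] w₂) : lap w₁ x = lap w₂ x := by
  refine Finset.sum_congr rfl fun i _ => ?_
  have h' : (fun y => fderiv ℝ w₁ y (EuclideanSpace.single i 1)) =ᶠ[nhds x]
      fun y => fderiv ℝ w₂ y (EuclideanSpace.single i 1) := by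
    filter_upwards [h.fderiv (𝕜 := ℝ)] with y hy
    rw [hy]
  rw [h'.fderiv_eq]

lemma lap_add {w₁ w₂ : EuclideanSpace ℝ (Fin n) → ℝ} (h₁ : ContDiff ℝ 2 w₁)
    (h₂ : ContDiff ℝ 2 w₂) (x : EuclideanSpace ℝ (Fin n)) :
    lap (fun y => w₁ y + w₂ y) x = lap w₁ x + lap w₂ x := by
  simp only [lap, ← Finset.sum_add_distrib]
  refine Finset.sum_congr rfl fun i _ => ?_
  have h : (fun y => fderiv ℝ (fun y => w₁ y + w₂ y) y (EuclideanSpace.single i 1)) =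
      fun y => fderiv ℝ w₁ y (EuclideanSpace.single i 1) +
        fderiv ℝ w₂ y (EuclideanSpace.single i 1) := by
    funext y
    rw [fderiv_fun_add (h₁.differentiable (by norm_num) y) (h₂.differentiable (by norm_num) y)]
    rfl
  rw [h, fderiv_fun_add ((contDiff_fderiv_apply h₁ _).differentiable (by norm_num) x)
    ((contDiff_fderiv_apply h₂ _).differentiable (by norm_num) x)]
  rfl

lemma lap_comp {g : ℝ → ℝ} (hg : ContDiff ℝ 2 g) {w : EuclideanSpace ℝ (Fin n) → ℝ}
    {x : EuclideanSpace ℝ (Fin n)} (hw : ContDiffAt ℝ 2 w x) :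
    lap (fun y => g (w y)) x = deriv (deriv g) (w x) * gradSq w x + deriv g (w x) * lap w x := by
  have hg' : Differentiable ℝ (deriv g) :=
    (hg.iterate_deriv' 1 1).differentiable (by norm_num)
  have hdw : ∀ᶠ y in nhds x, DifferentiableAt ℝ w y :=
    (hw.eventually (by norm_num)).mono fun y hy => hy.differentiableAt (by norm_num)
  simp only [lap, gradSq, Finset.mul_sum, ← Finset.sum_add_distrib]
  refine Finset.sum_congr rfl fun i _ => ?_
  have h : (fun y => fderiv ℝ (fun y => g (w y)) y (EuclideanSpace.single i 1)) =ᶠ[nhds x]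
      fun y => deriv g (w y) * fderiv ℝ w y (EuclideanSpace.single i 1) := by
    filter_upwards [hdw] with y hy
    have := ((hg.differentiable (by norm_num) (w y)).hasDerivAt).comp_hasFDerivAt y
      hy.hasFDerivAt
    have h2 := this.fderiv
    simp only [Function.comp_def] at h2
    rw [h2]
    simp
  rw [h.fderiv_eq]
  have hd1 := ((hg' (w x)).hasDerivAt).comp_hasFDerivAt x hdw.self_of_nhds.hasFDerivAt
  have hd2 := ((contDiffAt_fderiv_apply hw (EuclideanSpace.single i 1)).differentiableAt
    (by norm_num)).hasFDerivAt
  have h3 := (hd1.mul hd2).fderiv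
  simp only [Function.comp_def, Pi.mul_def] at h3
  rw [h3]
  simp
  ring

lemma lap_const_mul (c : ℝ) {w : EuclideanSpace ℝ (Fin n) → ℝ} (hw : ContDiff ℝ 2 w)
    (x : EuclideanSpace ℝ (Fin n)) : lap (fun y => c * w y) x = c * lap w x := by
  have h1 : deriv (fun t : ℝ => c * t) = fun _ => c := by
    funext t
    simp
  have := lap_comp (g := fun t => c * t) (by fun_prop) (hw.contDiffAt (x := x))
  simpa [h1] using this

lemma lap_const_sub_norm_sq (R : ℝ) (x : EuclideanSpace ℝ (Fin n)) :
    lap (fun y => R - ‖y‖ ^ 2) x = -(2 * n) := by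
  have h : ∀ i : Fin n, (fun y => fderiv ℝ (fun y : EuclideanSpace ℝ (Fin n) => R - ‖y‖ ^ 2) y
      (EuclideanSpace.single i 1)) = fun y => -(2 * y i) := by
    intro i
    funext y
    have := ((hasStrictFDerivAt_norm_sq y).hasFDerivAt.const_sub R).fderiv
    rw [this]
    simp [EuclideanSpace.inner_single_right]
  have h2 : ∀ i : Fin n, fderiv ℝ (fun y : EuclideanSpace ℝ (Fin n) => -(2 * y i)) x
      (EuclideanSpace.single i 1) = -2 := by
    intro i
    have h3 : HasFDerivAt (fun y : EuclideanSpace ℝ (Fin n) => -(2 * y i))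
        (-((2 : ℝ) • (EuclideanSpace.proj i : EuclideanSpace ℝ (Fin n) →L[ℝ] ℝ))) x :=
      ((EuclideanSpace.proj i : EuclideanSpace ℝ (Fin n) →L[ℝ] ℝ).hasFDerivAt.const_mul 2).neg
    rw [h3.fderiv]
    simp
  simp only [lap, h, h2]
  simp
  ring

lemma lap_sq_nonneg {u : EuclideanSpace ℝ (Fin n) → ℝ} {x : EuclideanSpace ℝ (Fin n)}
    (hu : ContDiffAt ℝ 2 u x) (h0 : lap u x = 0) : 0 ≤ lap (fun y => u y ^ 2) x := by
  have h1 : deriv (fun t : ℝ => t ^ 2) = fun t => 2 * t := by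
    funext t
    simp
  have h2 : deriv (fun t : ℝ => 2 * t) = fun _ => 2 := by
    funext t
    simp
  have := lap_comp (g := fun t => t ^ 2) (by fun_prop) hu
  rw [this, h1, h2, h0]
  have := gradSq_nonneg u x
  simp only [mul_zero, add_zero]
  positivity

end Laplacian

section Green

variable {n : ℕ}

lemma integrable_mul_of_tsupport_subset {Ω : Set (EuclideanSpace ℝ (Fin n))} (hΩ : IsOpen Ω)
    {φ g : EuclideanSpace ℝ (Fin n) → ℝ} (hφ : Continuous φ) (hc : HasCompactSupport φ)
    (hsub : tsupport φ ⊆ Ω) (hg : ContinuousOn g Ω) : Integrable (fun x => φ x * g x) := by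
  have hs : tsupport (fun x => φ x * g x) ⊆ tsupport φ := tsupport_mul_subset_left
  refine (continuous_of_tsupport fun x hx => ?_).integrable_of_hasCompactSupport hc.mul_right
  have hxΩ := hsub (hs hx)
  exact hφ.continuousAt.mul (hg.continuousAt (hΩ.mem_nhds hxΩ))

/-- Green's second identity against a compactly supported function. -/
lemma integral_mul_lap_comm {Ω : Set (EuclideanSpace ℝ (Fin n))} (hΩ : IsOpen Ω)
    {φ v : EuclideanSpace ℝ (Fin n) → ℝ} (hφ : ContDiff ℝ 2 φ) (hc : HasCompactSupport φ)
    (hsub : tsupport φ ⊆ Ω) (hv : ContDiffOn ℝ 2 v Ω) :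
    ∫ x, φ x * lap v x = ∫ x, lap φ x * v x := by
  have hvA : ∀ x ∈ Ω, ContDiffAt ℝ 2 v x := fun x hx => hv.contDiffAt (hΩ.mem_nhds hx)
  let e : Fin n → EuclideanSpace ℝ (Fin n) := fun i => EuclideanSpace.single i 1
  let dφ : Fin n → EuclideanSpace ℝ (Fin n) → ℝ := fun i y => fderiv ℝ φ y (e i)
  let dv : Fin n → EuclideanSpace ℝ (Fin n) → ℝ := fun i y => fderiv ℝ v y (e i)
  have hdφ : ∀ i, ContDiff ℝ 1 (dφ i) := fun i => contDiff_fderiv_apply hφ (e i)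
  have hdv : ∀ i, ∀ x ∈ Ω, ContDiffAt ℝ 1 (dv i) x := fun i x hx =>
    contDiffAt_fderiv_apply (hvA x hx) (e i)
  have hdφs : ∀ i, tsupport (dφ i) ⊆ tsupport φ := fun i => tsupport_fderiv_apply_subset ℝ (e i)
  have hdφc : ∀ i, HasCompactSupport (dφ i) := fun i => hc.fderiv_apply ℝ (e i)
  have hddφc : ∀ i, HasCompactSupport (fun x => fderiv ℝ (dφ i) x (e i)) := fun i =>
    (hdφc i).fderiv_apply ℝ (e i)
  have hddφs : ∀ i, tsupport (fun x => fderiv ℝ (dφ i) x (e i)) ⊆ Ω := fun i =>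
    ((tsupport_fderiv_apply_subset ℝ (e i)).trans (hdφs i)).trans hsub
  have hddφ : ∀ i, Continuous (fun x => fderiv ℝ (dφ i) x (e i)) := fun i =>
    ((hdφ i).continuous_fderiv (by norm_num)).clm_apply continuous_const
  have hvc : ContinuousOn v Ω := hv.continuousOn
  have hdvc : ∀ i, ContinuousOn (dv i) Ω := fun i x hx =>
    (hdv i x hx).continuousAt.continuousWithinAt
  have hddvc : ∀ i, ContinuousOn (fun x => fderiv ℝ (dv i) x (e i)) Ω := fun i x hx =>
    (((hdv i x hx).fderiv_right (m := 0) (by norm_num)).continuousAt.clm_apply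
      continuousAt_const).continuousWithinAt
  have I1 : ∀ i, Integrable (fun x => φ x * fderiv ℝ (dv i) x (e i)) := fun i =>
    integrable_mul_of_tsupport_subset hΩ hφ.continuous hc hsub (hddvc i)
  have I2 : ∀ i, Integrable (fun x => dφ i x * dv i x) := fun i =>
    integrable_mul_of_tsupport_subset hΩ (hdφ i).continuous (hdφc i) ((hdφs i).trans hsub) (hdvc i)
  have I3 : ∀ i, Integrable (fun x => fderiv ℝ (dφ i) x (e i) * v x) := fun i =>
    integrable_mul_of_tsupport_subset hΩ (hddφ i) (hddφc i) (hddφs i) hvc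
  have I4 : ∀ i, Integrable (fun x => φ x * dv i x) := fun i =>
    integrable_mul_of_tsupport_subset hΩ hφ.continuous hc hsub (hdvc i)
  have I5 : ∀ i, Integrable (fun x => dφ i x * v x) := fun i =>
    integrable_mul_of_tsupport_subset hΩ (hdφ i).continuous (hdφc i) ((hdφs i).trans hsub) hvc
  have E1 : ∀ i, ∫ x, φ x * fderiv ℝ (dv i) x (e i) = -∫ x, dφ i x * dv i x := fun i =>
    integral_mul_fderiv_eq_neg_fderiv_mul_of_integrable (I2 i) (I1 i) (I4 i)
      (fun x _ => hφ.differentiable (by norm_num) x)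
      (fun x hx => (hdv i x (hsub hx)).differentiableAt (by norm_num))
  have E2 : ∀ i, ∫ x, dφ i x * dv i x = -∫ x, fderiv ℝ (dφ i) x (e i) * v x := fun i =>
    integral_mul_fderiv_eq_neg_fderiv_mul_of_integrable (I3 i) (I2 i) (I5 i)
      (fun x _ => (hdφ i).differentiable (by norm_num) x)
      (fun x hx => (hvA x (hsub (hdφs i hx))).differentiableAt (by norm_num))
  simp only [lap, Finset.mul_sum, Finset.sum_mul]
  rw [integral_finsetSum _ fun i _ => I1 i, integral_finsetSum _ fun i _ => I3 i]
  refine Finset.sum_congr rfl fun i _ => ?_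
  have h1 := E1 i
  have h2 := E2 i
  linarith

/-- Squares of harmonic functions are subharmonic in the sense of distributions. -/
lemma setIntegral_lap_mul_sq_nonneg {Ω : Set (EuclideanSpace ℝ (Fin n))} (hΩ : IsOpen Ω)
    {φ u : EuclideanSpace ℝ (Fin n) → ℝ} (hφ : ContDiff ℝ 2 φ) (hφ0 : ∀ x, 0 ≤ φ x)
    (hc : HasCompactSupport φ) (hsub : tsupport φ ⊆ Ω) (hu : ContDiffOn ℝ 2 u Ω)
    (hharm : ∀ x ∈ Ω, lap u x = 0) :
    0 ≤ ∫ x in Ω, lap φ x * u x ^ 2 := by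
  have hsupp : ∀ x, x ∉ Ω → lap φ x = 0 := by
    intro x hx
    have h0 : φ =ᶠ[nhds x] fun _ => 0 := notMem_tsupport_iff_eventuallyEq.1 fun h => hx (hsub h)
    rw [lap_congr h0]
    simp [lap]
  rw [setIntegral_eq_integral_of_forall_compl_eq_zero fun x hx => by rw [hsupp x hx, zero_mul],
    ← integral_mul_lap_comm hΩ hφ hc hsub (hu.pow 2)]
  refine integral_nonneg fun x => ?_
  by_cases hx : x ∈ Ω
  · exact mul_nonneg (hφ0 x) (lap_sq_nonneg (hu.contDiffAt (hΩ.mem_nhds hx)) (hharm x hx))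
  · have : φ x = 0 := image_eq_zero_of_notMem_tsupport fun h => hx (hsub h)
    simp [this]

end Green

/-- A `C²` cutoff of `max (s - 1) 0`. -/
lemma exists_smooth_ramp : ∃ (g : ℝ → ℝ) (B : ℝ), ContDiff ℝ 2 g ∧ 0 < B ∧
    (∀ s, 0 ≤ g s) ∧ (∀ s ≤ 1, g s = 0) ∧ (∀ s, 0 ≤ deriv g s) ∧
    (∀ s, 2 ≤ s → deriv g s = 1) ∧ (∀ s, deriv (deriv g) s ≤ B) ∧
    (∀ s, 2 < s → deriv (deriv g) s = 0) := by
  let h : ℝ → ℝ := fun t => Real.smoothTransition (t - 1)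
  have hh : ContDiff ℝ 1 h :=
    (Real.smoothTransition.contDiff (n := 1)).comp (contDiff_id.sub contDiff_const)
  let g : ℝ → ℝ := fun s => ∫ t in (1 : ℝ)..s, h t
  have hg : ∀ s, HasDerivAt g (h s) s := fun s =>
    intervalIntegral.integral_hasDerivAt_right (hh.continuous.intervalIntegrable _ _)
      (hh.continuous.stronglyMeasurableAtFilter _ _) hh.continuous.continuousAt
  have hd : deriv g = h := funext fun s => (hg s).deriv
  have hh0 : ∀ s ≤ 1, h s = 0 := fun s hs =>
    Real.smoothTransition.zero_of_nonpos (by linarith)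
  have hg0 : ∀ s ≤ 1, g s = 0 := by
    intro s hs
    have : ∫ t in (1 : ℝ)..s, h t = ∫ t in (1 : ℝ)..s, (0 : ℝ) := by
      refine intervalIntegral.integral_congr fun t ht => hh0 t ?_
      rw [uIcc_of_ge hs] at ht
      exact ht.2
    simpa using this
  have hmono : Monotone g := monotone_of_deriv_nonneg (fun s => (hg s).differentiableAt)
    fun s => by rw [hd]; exact Real.smoothTransition.nonneg _
  have hh2 : ∀ s, 2 < s → deriv h s = 0 := by
    intro s hs
    have : h =ᶠ[nhds s] fun _ => 1 := by
      filter_upwards [lt_mem_nhds hs] with t ht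
      exact Real.smoothTransition.one_of_one_le (by linarith)
    rw [this.deriv_eq]
    simp
  have hh1 : ∀ s, s < 1 → deriv h s = 0 := by
    intro s hs
    have : h =ᶠ[nhds s] fun _ => 0 := by
      filter_upwards [gt_mem_nhds hs] with t ht
      exact hh0 t ht.le
    rw [this.deriv_eq]
    simp
  have hcont : Continuous (deriv h) := hh.continuous_deriv (by norm_num)
  obtain ⟨B, hB⟩ := (isCompact_Icc (a := (1 : ℝ)) (b := 2)).exists_bound_of_continuousOn
    hcont.continuousOn
  refine ⟨g, |B| + 1, ?_, by positivity, ?_, hg0, ?_, ?_, ?_, ?_⟩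
  · have : ContDiff ℝ (1 + 1) g := contDiff_succ_iff_deriv.2
      ⟨fun s => (hg s).differentiableAt, by simp, by rw [hd]; exact hh⟩
    simpa [one_add_one_eq_two] using this
  · intro s
    rcases le_total s 1 with h1 | h1
    · exact (hg0 s h1).ge
    · exact (hg0 1 le_rfl).ge.trans (hmono h1)
  · intro s
    rw [hd]
    exact Real.smoothTransition.nonneg _
  · intro s hs
    rw [hd]
    exact Real.smoothTransition.one_of_one_le (by linarith)
  · intro s
    rw [hd]
    rcases lt_or_ge s 1 with h1 | h1
    · rw [hh1 s h1]; positivity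
    rcases lt_or_ge 2 s with h2 | h2
    · rw [hh2 s h2]; positivity
    have := hB s ⟨h1, h2⟩
    rw [Real.norm_eq_abs] at this
    linarith [le_abs_self (deriv h s), le_abs_self B]
  · intro s hs
    rw [hd]
    exact hh2 s hs

section Domain

variable {n : ℕ} {Ω : Set (EuclideanSpace ℝ (Fin n))} {F : EuclideanSpace ℝ (Fin n) → ℝ}

lemma C2Domain.isCompact_closure (hdom : C2Domain n Ω F) : IsCompact (closure Ω) :=
  hdom.bounded.isCompact_closure

lemma C2Domain.neg_of_mem (hdom : C2Domain n Ω F) {x : EuclideanSpace ℝ (Fin n)} (hx : x ∈ Ω) :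
    F x < 0 := by
  rw [hdom.eq_sublevel] at hx
  exact hx

lemma C2Domain.mem_of_neg (hdom : C2Domain n Ω F) {x : EuclideanSpace ℝ (Fin n)} (hx : F x < 0) :
    x ∈ Ω := by
  rw [hdom.eq_sublevel]
  exact hx

lemma C2Domain.mem_or_mem_frontier {x : EuclideanSpace ℝ (Fin n)} (hx : x ∈ closure Ω) :
    x ∈ Ω ∨ x ∈ frontier Ω := by
  rw [closure_eq_self_union_frontier] at hx
  exact hx

lemma C2Domain.eq_zero_of_mem_frontier (hdom : C2Domain n Ω F) {x : EuclideanSpace ℝ (Fin n)}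
    (hx : x ∈ frontier Ω) : F x = 0 := by
  rw [hdom.eq_frontier] at hx
  exact hx

lemma C2Domain.exists_partial_ne_zero (hdom : C2Domain n Ω F) {p : EuclideanSpace ℝ (Fin n)}
    (hp : p ∈ frontier Ω) : ∃ i : Fin n, fderiv ℝ F p (EuclideanSpace.single i 1) ≠ 0 := by
  by_contra! h
  refine hdom.grad_ne p hp ?_
  have h0 : fderiv ℝ F p = 0 := by
    ext x
    have hx := (EuclideanSpace.basisFun (Fin n) ℝ).sum_repr x
    rw [← hx, map_sum]
    simp [h]
  rw [gradient, h0, map_zero]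

/-- The distance to the boundary is controlled by the defining function. -/
lemma C2Domain.exists_infDist_le (hdom : C2Domain n Ω F) :
    ∃ K : ℝ, ∀ x ∈ Ω, infDist x (frontier Ω) ≤ K * (-F x) := by
  have key : ∃ K : ℝ, ∀ x ∈ closure Ω ∩ Ω, infDist x (frontier Ω) ≤ K * (-F x) := by
    refine hdom.isCompact_closure.induction_on
      (p := fun s => ∃ K : ℝ, ∀ x ∈ s ∩ Ω, infDist x (frontier Ω) ≤ K * (-F x)) ?_ ?_ ?_ ?_
    · exact ⟨0, fun x hx => absurd hx.1 (notMem_empty x)⟩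
    · rintro s t hst ⟨K, hK⟩
      exact ⟨K, fun x hx => hK x ⟨hst hx.1, hx.2⟩⟩
    · rintro s t ⟨K₁, h₁⟩ ⟨K₂, h₂⟩
      refine ⟨max K₁ K₂, ?_⟩
      rintro x ⟨hx | hx, hxΩ⟩
      · have := hdom.neg_of_mem hxΩ
        exact (h₁ x ⟨hx, hxΩ⟩).trans
          (mul_le_mul_of_nonneg_right (le_max_left _ _) (by linarith))
      · have := hdom.neg_of_mem hxΩ
        exact (h₂ x ⟨hx, hxΩ⟩).trans
          (mul_le_mul_of_nonneg_right (le_max_right _ _) (by linarith))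
    intro p hp
    suffices h : ∃ K : ℝ, ∀ᶠ x in nhds p, x ∈ Ω → infDist x (frontier Ω) ≤ K * (-F x) by
      obtain ⟨K, hK⟩ := h
      exact ⟨_, mem_nhdsWithin_of_mem_nhds hK, K, fun x hx => hx.1 hx.2⟩
    have hFc : ContinuousAt F p := hdom.smooth.continuous.continuousAt
    rcases C2Domain.mem_or_mem_frontier hp with hpΩ | hpf
    · have hneg := hdom.neg_of_mem hpΩ
      have hd : ContinuousAt (fun x => infDist x (frontier Ω)) p :=
        (continuous_infDist_pt _).continuousAt
      have hpos : 0 ≤ infDist p (frontier Ω) := infDist_nonneg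
      refine ⟨2 * (infDist p (frontier Ω) + 1) / (-F p), ?_⟩
      filter_upwards [hd.eventually_lt (continuousAt_const (y := infDist p (frontier Ω) + 1))
        (by linarith), hFc.eventually_lt (continuousAt_const (y := F p / 2)) (by linarith)]
        with x h1 h2 _
      calc infDist x (frontier Ω) ≤ infDist p (frontier Ω) + 1 := h1.le
        _ = 2 * (infDist p (frontier Ω) + 1) / (-F p) * (-(F p / 2)) := by
            have : F p ≠ 0 := hneg.ne
            field_simp
        _ ≤ _ := by
            refine mul_le_mul_of_nonneg_left (by linarith) ?_
            exact div_nonneg (by linarith) (by linarith)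
    · obtain ⟨i, hi⟩ := hdom.exists_partial_ne_zero hpf
      have hF0 := hdom.eq_zero_of_mem_frontier hpf
      set a := fderiv ℝ F p (EuclideanSpace.single i 1) with ha
      let v : EuclideanSpace ℝ (Fin n) := a⁻¹ • EuclideanSpace.single i 1
      have hv : fderiv ℝ F p v = 1 := by
        simp only [v, map_smul, smul_eq_mul, ← ha]
        exact inv_mul_cancel₀ hi
      have hstrict : HasStrictFDerivAt F (fderiv ℝ F p) p :=
        hdom.smooth.contDiffAt.hasStrictFDerivAt (by norm_num)
      have hη : 0 < 1 / (2 * (‖v‖ + 1)) := by positivity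
      have hlit := hstrict.isLittleO.def hη
      have htend : Filter.Tendsto (fun x => (x + (-2 * F x) • v, x)) (nhds p) (nhds (p, p)) := by
        have hc : ContinuousAt (fun x => (x + (-2 * F x) • v, x)) p := by fun_prop
        have := hc.tendsto
        simpa [hF0] using this
      refine ⟨2 * ‖v‖, ?_⟩
      filter_upwards [htend.eventually hlit] with x hx hxΩ
      have hneg := hdom.neg_of_mem hxΩ
      simp only [add_sub_cancel_left, map_smul, hv, smul_eq_mul, mul_one, norm_smul] at hx
      rw [Real.norm_eq_abs, Real.norm_eq_abs, abs_of_pos (by linarith : 0 < -2 * F x)] at hx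
      have hb : 1 / (2 * (‖v‖ + 1)) * (-2 * F x * ‖v‖) ≤ -F x := by
        rw [div_mul_eq_mul_div, div_le_iff₀ (by positivity)]
        nlinarith [norm_nonneg v]
      have hend : 0 ≤ F (x + (-2 * F x) • v) := by
        have := neg_abs_le (F (x + (-2 * F x) • v) - F x - -2 * F x)
        linarith
      have hcont : ContinuousOn (fun t : ℝ => F (x + t • v)) (Icc 0 (-2 * F x)) := by
        have := hdom.smooth.continuous
        fun_prop
      have hivt := intermediate_value_Icc (by linarith : (0 : ℝ) ≤ -2 * F x) hcont
      obtain ⟨t, ht, ht0⟩ := hivt (show (0 : ℝ) ∈ _ from ⟨by simpa using hneg.le, hend⟩)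
      have hmem : x + t • v ∈ frontier Ω := by
        rw [hdom.eq_frontier]
        exact ht0
      calc infDist x (frontier Ω) ≤ dist x (x + t • v) := infDist_le_dist_of_mem hmem
        _ = t * ‖v‖ := by rw [dist_self_add_right, norm_smul, Real.norm_eq_abs, abs_of_nonneg ht.1]
        _ ≤ (-2 * F x) * ‖v‖ := mul_le_mul_of_nonneg_right ht.2 (norm_nonneg v)
        _ = 2 * ‖v‖ * (-F x) := by ring
  obtain ⟨K, hK⟩ := key
  exact ⟨K, fun x hx => hK x ⟨subset_closure hx, hx⟩⟩

lemma C2Domain.exists_le_gradSq (hdom : C2Domain n Ω F) :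
    ∃ ε > 0, ∃ c > 0, ∀ x ∈ Ω, -(2 * ε) ≤ F x → c ≤ gradSq F x := by
  have hpos : ∀ x ∈ closure Ω, 0 < gradSq F x - F x := by
    intro x hx
    have h0 := gradSq_nonneg F x
    rcases C2Domain.mem_or_mem_frontier hx with hx | hx
    · linarith [hdom.neg_of_mem hx]
    · obtain ⟨i, hi⟩ := hdom.exists_partial_ne_zero hx
      rw [hdom.eq_zero_of_mem_frontier hx, sub_zero]
      exact Finset.sum_pos' (fun _ _ => sq_nonneg _) ⟨i, Finset.mem_univ i, by positivity⟩
  have hcont : ContinuousOn (fun x => gradSq F x - F x) (closure Ω) :=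
    ((continuous_gradSq hdom.smooth).sub hdom.smooth.continuous).continuousOn
  obtain ⟨x₀, hx₀, hmin⟩ :=
    hdom.isCompact_closure.exists_isMinOn (hdom.connected.nonempty.closure) hcont
  have hm := hpos x₀ hx₀
  refine ⟨(gradSq F x₀ - F x₀) / 4, by linarith, (gradSq F x₀ - F x₀) / 2, by linarith, ?_⟩
  intro x hx hFx
  have := hmin (subset_closure hx)
  simp only [mem_ofPred_eq] at this
  linarith

/-- A strictly superharmonic `C²` function on `Ω`, comparable to the distance to the boundary. -/
lemma C2Domain.exists_barrier (hdom : C2Domain n Ω F) (hn : 0 < n) :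
    ∃ (w : EuclideanSpace ℝ (Fin n) → ℝ) (c L K : ℝ), ContDiff ℝ 2 w ∧ 0 < c ∧ 0 < L ∧ 0 < K ∧
      (∀ x, x ∉ Ω → w x ≤ 0) ∧ (∀ x ∈ Ω, lap w x ≤ -c) ∧ (∀ x ∈ Ω, gradSq w x ≤ L) ∧
      (∀ x ∈ Ω, infDist x (frontier Ω) ≤ K * w x) := by
  obtain ⟨ε, hε, c₀, hc₀, hgrad⟩ := hdom.exists_le_gradSq
  obtain ⟨K₀, hK₀⟩ := hdom.exists_infDist_le
  have hcpt := hdom.isCompact_closure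
  obtain ⟨R, hR⟩ := hcpt.exists_bound_of_continuousOn (continuous_id.continuousOn)
  have hF := hdom.smooth
  let χ : ℝ → ℝ := fun t => Real.smoothTransition ((-t - ε) / ε)
  let φ : EuclideanSpace ℝ (Fin n) → ℝ := fun x => χ (F x) * (R ^ 2 - ‖x‖ ^ 2)
  have hχ : ContDiff ℝ 2 χ :=
    (Real.smoothTransition.contDiff (n := 2)).comp ((contDiff_neg.sub contDiff_const).div_const ε)
  have hφ : ContDiff ℝ 2 φ := (hχ.comp hF).mul (contDiff_const.sub (contDiff_norm_sq ℝ))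
  obtain ⟨C₀, hC₀⟩ := hcpt.exists_bound_of_continuousOn (continuous_lap hF).continuousOn
  obtain ⟨C₁, hC₁⟩ := hcpt.exists_bound_of_continuousOn (continuous_lap hφ).continuousOn
  obtain ⟨m, hm⟩ := hcpt.exists_bound_of_continuousOn hF.continuous.continuousOn
  have hφ0 : ∀ x ∈ Ω, 0 ≤ φ x := by
    intro x hx
    have h1 : ‖x‖ ≤ R := hR x (subset_closure hx)
    exact mul_nonneg (Real.smoothTransition.nonneg _) (by nlinarith [norm_nonneg x])
  have hφout : ∀ x, x ∉ Ω → φ x = 0 := by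
    intro x hx
    have h1 : 0 ≤ F x := not_lt.1 fun h => hx (hdom.mem_of_neg h)
    have : χ (F x) = 0 := Real.smoothTransition.zero_of_nonpos
      (div_nonpos_of_nonpos_of_nonneg (by linarith) hε.le)
    simp [φ, this]
  have hφin : ∀ x, F x < -(2 * ε) → lap φ x = -(2 * n) := by
    intro x hx
    have h : φ =ᶠ[nhds x] fun y => R ^ 2 - ‖y‖ ^ 2 := by
      filter_upwards [hF.continuous.continuousAt.eventually_lt continuousAt_const hx] with y hy
      have : χ (F y) = 1 := Real.smoothTransition.one_of_one_le (by
        rw [le_div_iff₀ hε]; linarith)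
      simp [φ, this]
    rw [lap_congr h, lap_const_sub_norm_sq]
  obtain ⟨x₀, hx₀⟩ := hdom.connected.nonempty
  have hC₀0 : 0 ≤ C₀ := (norm_nonneg _).trans (hC₀ x₀ (subset_closure hx₀))
  have hC₁0 : 0 ≤ C₁ := (norm_nonneg _).trans (hC₁ x₀ (subset_closure hx₀))
  have hm0 : 0 ≤ m := (norm_nonneg _).trans (hm x₀ (subset_closure hx₀))
  set D := C₀ + 1 with hD
  set k := (C₀ + D * C₁ + 1) / c₀ with hk
  have hk0 : 0 < k := by positivity
  have hkc : k * c₀ = C₀ + D * C₁ + 1 := by rw [hk]; field_simp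
  set E := Real.exp (-(2 * ε * k)) with hE
  have hE0 : 0 < E := Real.exp_pos _
  let g : ℝ → ℝ := fun t => 1 - Real.exp (k * t)
  have hg : ContDiff ℝ 2 g := by fun_prop
  have hg1 : deriv g = fun t => -(k * Real.exp (k * t)) := by
    funext t
    have := (((hasDerivAt_id t).const_mul k).exp.const_sub 1).deriv
    simp only [id, mul_one] at this
    rw [this]
    ring
  have hg2 : deriv (deriv g) = fun t => -(k ^ 2 * Real.exp (k * t)) := by
    rw [hg1]
    funext t
    have := ((((hasDerivAt_id t).const_mul k).exp.const_mul k).neg).deriv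
    simp only [id, mul_one] at this
    refine Eq.trans this ?_
    ring
  let w : EuclideanSpace ℝ (Fin n) → ℝ := fun x => g (F x) + (D * k * E) * φ x
  have hw : ContDiff ℝ 2 w := (hg.comp hF).add (contDiff_const.mul hφ)
  have hlap : ∀ x, lap w x = -(k ^ 2 * Real.exp (k * F x)) * gradSq F x +
      -(k * Real.exp (k * F x)) * lap F x + D * k * E * lap φ x := by
    intro x
    have h1 := lap_add (hg.comp hF) (contDiff_const.mul hφ : ContDiff ℝ 2 fun y => D * k * E * φ y) x
    have h2 := lap_comp hg (hF.contDiffAt (x := x))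
    simp only [Function.comp_def] at h1
    rw [h1, h2, lap_const_mul _ hφ, hg2, hg1]
  obtain ⟨L, hL⟩ := hcpt.exists_bound_of_continuousOn (continuous_gradSq hw).continuousOn
  refine ⟨w, k * E, |L| + 1, |K₀| * (1 + k * m) / k + 1, hw, by positivity, by positivity,
    by positivity, ?_, ?_, ?_, ?_⟩
  · intro x hx
    have h1 : 0 ≤ F x := not_lt.1 fun h => hx (hdom.mem_of_neg h)
    have : 1 ≤ Real.exp (k * F x) := Real.one_le_exp (by positivity)
    simp only [w, g, hφout x hx]
    linarith
  · intro x hx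
    have hb₀ := hC₀ x (subset_closure hx)
    have hb₁ := hC₁ x (subset_closure hx)
    rw [Real.norm_eq_abs, abs_le] at hb₀ hb₁
    rw [hlap]
    set X := Real.exp (k * F x) with hX
    have hX0 : 0 < X := Real.exp_pos _
    rcases lt_or_ge (F x) (-(2 * ε)) with h | h
    · have hXE : X ≤ E := Real.exp_le_exp.2 (by nlinarith)
      rw [hφin x h]
      have hn1 : (1 : ℝ) ≤ n := by exact_mod_cast hn
      have t1 : 0 ≤ k ^ 2 * X * gradSq F x :=
        mul_nonneg (by positivity) (gradSq_nonneg F x)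
      have t2 : -(k * X) * lap F x ≤ k * E * C₀ := by
        calc -(k * X) * lap F x = (k * X) * (-lap F x) := by ring
          _ ≤ (k * X) * C₀ := mul_le_mul_of_nonneg_left (by linarith) (by positivity)
          _ ≤ (k * E) * C₀ := by gcongr
      have t3 : D * k * E ≤ D * k * E * n := le_mul_of_one_le_right (by positivity) hn1
      have t4 : 0 ≤ D * k * E := by positivity
      have t5 : D * k * E = k * E * C₀ + k * E := by rw [hD]; ring
      nlinarith
    · have hXE : E ≤ X := Real.exp_le_exp.2 (by nlinarith)
      have hgr := hgrad x hx h
      have t1 : k ^ 2 * X * c₀ ≤ k ^ 2 * X * gradSq F x :=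
        mul_le_mul_of_nonneg_left hgr (by positivity)
      have t2 : -(k * X) * lap F x ≤ k * X * C₀ := by
        calc -(k * X) * lap F x = (k * X) * (-lap F x) := by ring
          _ ≤ (k * X) * C₀ := mul_le_mul_of_nonneg_left (by linarith) (by positivity)
      have t3 : D * k * E * lap φ x ≤ D * k * X * C₁ := by
        calc D * k * E * lap φ x ≤ D * k * E * C₁ :=
              mul_le_mul_of_nonneg_left hb₁.2 (by positivity)
          _ ≤ _ := by gcongr
      have t4 : k ^ 2 * X * c₀ = k * X * (C₀ + D * C₁ + 1) := by rw [← hkc]; ring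
      have t5 : k * E ≤ k * X := by gcongr
      nlinarith
  · intro x hx
    have := hL x (subset_closure hx)
    rw [Real.norm_eq_abs] at this
    linarith [le_abs_self (gradSq w x), le_abs_self L]
  · intro x hx
    have hneg := hdom.neg_of_mem hx
    have hmx := hm x (subset_closure hx)
    rw [Real.norm_eq_abs, abs_of_neg hneg] at hmx
    set s := -F x with hs
    have hs0 : 0 < s := by linarith
    have hgs : k * s / (1 + k * m) ≤ g (F x) := by
      have h1 : 1 + k * s ≤ Real.exp (k * s) := by linarith [Real.add_one_le_exp (k * s)]
      have h2 : Real.exp (k * F x) = (Real.exp (k * s))⁻¹ := by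
        rw [← Real.exp_neg, hs]; congr 1; ring
      have h3 : (Real.exp (k * s))⁻¹ ≤ (1 + k * s)⁻¹ := inv_anti₀ (by positivity) h1
      calc k * s / (1 + k * m) ≤ k * s / (1 + k * s) := by gcongr
        _ = 1 - (1 + k * s)⁻¹ := by field_simp; ring
        _ ≤ g (F x) := by simp only [g, h2]; linarith
    have hgw : g (F x) ≤ w x := by
      have : 0 ≤ D * k * E * φ x := mul_nonneg (by positivity) (hφ0 x hx)
      simp only [w]
      linarith
    have hw0 : 0 ≤ w x := le_trans (by positivity) (hgs.trans hgw)
    calc infDist x (frontier Ω) ≤ K₀ * s := hK₀ x hx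
      _ ≤ |K₀| * s := mul_le_mul_of_nonneg_right (le_abs_self _) hs0.le
      _ = |K₀| * (1 + k * m) / k * (k * s / (1 + k * m)) := by field_simp
      _ ≤ |K₀| * (1 + k * m) / k * w x :=
          mul_le_mul_of_nonneg_left (hgs.trans hgw) (by positivity)
      _ ≤ _ := mul_le_mul_of_nonneg_right (by linarith) hw0

end Domain

section Collar

variable {n : ℕ} {Ω : Set (EuclideanSpace ℝ (Fin n))} {F : EuclideanSpace ℝ (Fin n) → ℝ}

/-- The mass of the square of a harmonic function is controlled by its mass near the boundary. -/
lemma C2Domain.exists_collar_estimate (hdom : C2Domain n Ω F) (hn : 0 < n) {δ : ℝ} (hδ : 0 < δ) :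
    ∃ C > 0, ∀ ρ, 0 < ρ → ρ < δ → ∀ u : EuclideanSpace ℝ (Fin n) → ℝ, ContDiffOn ℝ 2 u Ω →
      ContinuousOn u (closure Ω) → (∀ x ∈ Ω, lap u x = 0) →
      ∫ x in Ω, u x ^ 2 ≤ C / ρ * ∫ x in Ω ∩ {x | infDist x (frontier Ω) < ρ / 2}, u x ^ 2 := by
  obtain ⟨w, c, L, K, hw, hc, hL, hK, hwout, hwlap, hwgrad, hwdist⟩ := hdom.exists_barrier hn
  obtain ⟨g, B, hg, hB, hg0, hg1, hg', hg'1, hg'', hg''0⟩ := exists_smooth_ramp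
  refine ⟨(c * δ + B * L * (8 * K)) / c, by positivity, ?_⟩
  intro ρ hρ hρδ u hu huc hharm
  set τ := ρ / (8 * K) with hτ
  have hτ0 : 0 < τ := by positivity
  set A := {x : EuclideanSpace ℝ (Fin n) | infDist x (frontier Ω) < ρ / 2} with hA
  have hAm : MeasurableSet A := (isOpen_lt (continuous_infDist_pt _) continuous_const).measurableSet
  have hΩm : MeasurableSet Ω := hdom.isOpen.measurableSet
  let G : ℝ → ℝ := fun s => τ * g (s / τ)
  have hG : ContDiff ℝ 2 G := contDiff_const.mul (hg.comp (contDiff_id.div_const τ))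
  have hgd : Differentiable ℝ g := hg.differentiable (by norm_num)
  have hgd' : Differentiable ℝ (deriv g) := (hg.iterate_deriv' 1 1).differentiable (by norm_num)
  have hG1 : deriv G = fun s => deriv g (s / τ) := by
    funext s
    have h1 : HasDerivAt (fun s => s / τ) (1 / τ) s := (hasDerivAt_id s).div_const τ
    have h2 := (((hgd (s / τ)).hasDerivAt.comp s h1).const_mul τ).deriv
    refine Eq.trans h2 ?_
    field_simp
  have hG2 : deriv (deriv G) = fun s => deriv (deriv g) (s / τ) / τ := by
    rw [hG1]
    funext s
    have h1 : HasDerivAt (fun s => s / τ) (1 / τ) s := (hasDerivAt_id s).div_const τ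
    have h2 := ((hgd' (s / τ)).hasDerivAt.comp s h1).deriv
    refine Eq.trans h2 ?_
    field_simp
  let φ : EuclideanSpace ℝ (Fin n) → ℝ := fun x => G (w x)
  have hφ : ContDiff ℝ 2 φ := hG.comp hw
  have hφ0 : ∀ x, 0 ≤ φ x := fun x => mul_nonneg hτ0.le (hg0 _)
  have hsupp : tsupport φ ⊆ {x | τ ≤ w x} := by
    refine closure_minimal ?_ (isClosed_le continuous_const hw.continuous)
    intro x hx
    by_contra h
    refine hx ?_
    have h1 : w x / τ ≤ 1 := by
      rw [div_le_one hτ0]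
      exact (not_le.1 h).le
    simp [φ, G, hg1 _ h1]
  have hsub : tsupport φ ⊆ Ω := by
    intro x hx
    by_contra h
    have h1 : τ ≤ w x := hsupp hx
    linarith [hwout x h]
  have hcs : HasCompactSupport φ :=
    hdom.isCompact_closure.of_isClosed_subset (isClosed_tsupport φ) (hsub.trans subset_closure)
  have hgreen := setIntegral_lap_mul_sq_nonneg hdom.isOpen hφ hφ0 hcs hsub hu hharm
  have hint : IntegrableOn (fun x => u x ^ 2) Ω :=
    ((huc.pow 2).integrableOn_compact hdom.isCompact_closure).mono_set subset_closure
  have hint2 : IntegrableOn (fun x => lap φ x * u x ^ 2) Ω :=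
    (((continuous_lap hφ).continuousOn.mul (huc.pow 2)).integrableOn_compact
      hdom.isCompact_closure).mono_set subset_closure
  set M := c + B * L / τ with hM
  have hM0 : 0 < M := by positivity
  have hint3 : IntegrableOn (fun x => M * A.indicator (fun x => u x ^ 2) x - c * u x ^ 2) Ω :=
    ((hint.indicator hAm).const_mul M).sub (hint.const_mul c)
  have hle : ∫ x in Ω, lap φ x * u x ^ 2 ≤
      ∫ x in Ω, (M * A.indicator (fun x => u x ^ 2) x - c * u x ^ 2) := by
    refine setIntegral_mono_on hint2 hint3 hΩm fun x hx => ?_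
    have hcomp : lap φ x = deriv (deriv g) (w x / τ) / τ * gradSq w x +
        deriv g (w x / τ) * lap w x := by
      have := lap_comp hG (hw.contDiffAt (x := x))
      rw [hG2, hG1] at this
      exact this
    have hu2 := sq_nonneg (u x)
    rcases lt_or_ge 2 (w x / τ) with h | h
    · rw [hcomp, hg''0 _ h, hg'1 _ h.le, zero_div, zero_mul, zero_add, one_mul]
      have h1 : lap w x * u x ^ 2 ≤ -c * u x ^ 2 := mul_le_mul_of_nonneg_right (hwlap x hx) hu2
      have h2 : 0 ≤ M * A.indicator (fun x => u x ^ 2) x :=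
        mul_nonneg hM0.le (indicator_nonneg (fun _ _ => sq_nonneg _) x)
      linarith
    · have hxA : x ∈ A := by
        rw [div_le_iff₀ hτ0] at h
        have h1 : K * w x ≤ K * (2 * τ) := mul_le_mul_of_nonneg_left h hK.le
        have h2 : K * (2 * τ) = ρ / 4 := by
          rw [hτ]; field_simp; norm_num
        have := hwdist x hx
        simp only [hA, mem_ofPred_eq]
        linarith
      rw [indicator_of_mem hxA, ← sub_mul]
      refine mul_le_mul_of_nonneg_right ?_ hu2
      have h1 : deriv (deriv g) (w x / τ) / τ * gradSq w x ≤ B / τ * L := by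
        refine mul_le_mul ?_ (hwgrad x hx) (gradSq_nonneg w x) (by positivity)
        gcongr
        exact hg'' _
      have h2 : deriv g (w x / τ) * lap w x ≤ 0 :=
        mul_nonpos_of_nonneg_of_nonpos (hg' _) (by linarith [hwlap x hx])
      rw [hcomp, hM]
      have h3 : B / τ * L = B * L / τ := by ring
      linarith
  rw [integral_sub ((hint.indicator hAm).const_mul M) (hint.const_mul c),
    integral_const_mul, integral_const_mul, setIntegral_indicator hAm] at hle
  set I := ∫ x in Ω, u x ^ 2
  set J := ∫ x in Ω ∩ A, u x ^ 2 with hJ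
  have hJ0 : 0 ≤ J := integral_nonneg fun x => sq_nonneg _
  have hIJ : c * I ≤ M * J := by linarith
  have hMρ : M ≤ (c * δ + B * L * (8 * K)) / ρ := by
    have h1 : B * L / τ = B * L * (8 * K) / ρ := by rw [hτ]; field_simp
    have h2 : c ≤ c * δ / ρ := by
      rw [le_div_iff₀ hρ]
      gcongr
    rw [hM, h1, add_div]
    linarith
  have hfin : c * I ≤ (c * δ + B * L * (8 * K)) / ρ * J :=
    hIJ.trans (mul_le_mul_of_nonneg_right hMρ hJ0)
  calc I = c * I / c := by field_simp
    _ ≤ (c * δ + B * L * (8 * K)) / ρ * J / c := by gcongr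
    _ = _ := by ring

end Collar

section Covering

/-- A set with bounded coordinates has a net in these coordinates of polynomial size. -/
lemma exists_finset_net {ι X : Type*} [Fintype ι] (E : Set X) (q : X → ι → ℝ) {R h : ℝ}
    (hR : 0 ≤ R) (hqR : ∀ x ∈ E, ∀ j, |q x j| ≤ R) (hh : 0 < h) :
    ∃ T : Finset X, (T : Set X) ⊆ E ∧ (T.card : ℝ) ≤ (2 * (R / h) + 3) ^ Fintype.card ι ∧
      ∀ x ∈ E, ∃ t ∈ T, ∀ j, |q x j - q t j| ≤ h := by
  classical
  let label : X → ι → ℤ := fun x j => ⌊q x j / h⌋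
  let N : ℕ := ⌈R / h⌉₊
  let S : Finset (ι → ℤ) := Fintype.piFinset fun _ => Finset.Icc (-(N : ℤ)) N
  have hN : R / h ≤ N := Nat.le_ceil _
  have hN' : (N : ℝ) < R / h + 1 := Nat.ceil_lt_add_one (by positivity)
  have hlabel : label '' E ⊆ S := by
    rintro _ ⟨x, hx, rfl⟩
    refine Finset.mem_coe.2 (Fintype.mem_piFinset.2 fun j => Finset.mem_Icc.2 ?_)
    have h1 : |q x j / h| ≤ N := by
      rw [abs_div, abs_of_pos hh]
      exact (div_le_div_of_nonneg_right (hqR x hx j) hh.le).trans hN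
    rw [abs_le] at h1
    constructor
    · exact Int.le_floor.2 (by push_cast; exact h1.1)
    · have : ((⌊q x j / h⌋ : ℤ) : ℝ) ≤ N := (Int.floor_le _).trans h1.2
      exact_mod_cast this
  obtain ⟨t, htE, htbij⟩ := exists_subset_bijOn E label
  have hfinl : (label '' E).Finite := S.finite_toSet.subset hlabel
  have htfin : t.Finite := htbij.finite_iff_finite.2 hfinl
  refine ⟨htfin.toFinset, by simpa using htE, ?_, ?_⟩
  · have hcard : htfin.toFinset.card ≤ S.card := by
      refine Finset.card_le_card_of_injOn label (fun x hx => ?_) ?_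
      · exact hlabel ⟨x, htE (htfin.mem_toFinset.1 hx), rfl⟩
      · simpa using htbij.injOn
    have hS : S.card = (2 * N + 1) ^ Fintype.card ι := by
      have hIcc : (Finset.Icc (-(N : ℤ)) N).card = 2 * N + 1 := by
        rw [Int.card_Icc]
        omega
      simp [S, Fintype.card_piFinset, hIcc]
    calc (htfin.toFinset.card : ℝ) ≤ ((2 * N + 1) ^ Fintype.card ι : ℕ) := by
          rw [← hS]; exact_mod_cast hcard
      _ = (2 * (N : ℝ) + 1) ^ Fintype.card ι := by push_cast; rfl
      _ ≤ _ := pow_le_pow_left₀ (by positivity) (by linarith) _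
  · intro x hx
    obtain ⟨y, hy, hyx⟩ := htbij.surjOn ⟨x, hx, rfl⟩
    refine ⟨y, htfin.mem_toFinset.2 hy, fun j => ?_⟩
    have hfl : ⌊q x j / h⌋ = ⌊q y j / h⌋ := (congrFun hyx j).symm
    have h1 := Int.abs_sub_lt_one_of_floor_eq_floor hfl
    rw [← sub_div, abs_div, abs_of_pos hh, div_lt_one hh] at h1
    exact h1.le

variable {n : ℕ} {Ω : Set (EuclideanSpace ℝ (Fin n))} {F : EuclideanSpace ℝ (Fin n) → ℝ}

lemma EuclideanSpace.norm_le_card_mul {x : EuclideanSpace ℝ (Fin n)} {h : ℝ}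
    (hx : ∀ j, |x j| ≤ h) : ‖x‖ ≤ n * h := by
  have hsum := (EuclideanSpace.basisFun (Fin n) ℝ).sum_repr x
  calc ‖x‖ = ‖∑ j, x j • EuclideanSpace.single j (1 : ℝ)‖ := by
        conv_lhs => rw [← hsum]
        simp
    _ ≤ ∑ j : Fin n, ‖x j • EuclideanSpace.single j (1 : ℝ)‖ := norm_sum_le _ _
    _ ≤ ∑ _j : Fin n, h := by
        refine Finset.sum_le_sum fun j _ => ?_
        simpa [norm_smul] using hx j
    _ = n * h := by simp

/-- Near each of its points, the boundary is a Lipschitz graph over a coordinate hyperplane. -/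
lemma C2Domain.exists_frontier_lipschitz (hdom : C2Domain n Ω F) {p : EuclideanSpace ℝ (Fin n)}
    (hp : p ∈ frontier Ω) : ∃ (i : Fin n), ∃ C > 0, ∃ U ∈ nhds p, ∀ x ∈ U ∩ frontier Ω,
      ∀ y ∈ U ∩ frontier Ω, ∀ h, 0 ≤ h → (∀ j : {j // j ≠ i}, |x j - y j| ≤ h) →
        dist x y ≤ C * h := by
  obtain ⟨i, hi⟩ := hdom.exists_partial_ne_zero hp
  set f := fderiv ℝ F p with hf
  set a := f (EuclideanSpace.single i 1) with ha
  have ha0 : 0 < |a| := abs_pos.2 hi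
  have hstrict : HasStrictFDerivAt F f p := hdom.smooth.contDiffAt.hasStrictFDerivAt (by norm_num)
  have hlit := hstrict.isLittleO.def (half_pos ha0)
  rw [nhds_prod_eq] at hlit
  obtain ⟨U, hU, hlit⟩ := (Filter.eventually_prod_self_iff
    (r := fun x y => ‖F x - F y - f (x - y)‖ ≤ |a| / 2 * ‖x - y‖)).1 hlit
  have hn : (0 : ℝ) < n := by exact_mod_cast i.pos
  refine ⟨i, (2 + 2 * ‖f‖ / |a|) * n, by positivity, U, hU, ?_⟩
  rintro x ⟨hxU, hx⟩ y ⟨hyU, hy⟩ h hh hxy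
  have hd := hlit x hxU y hyU
  simp only [hdom.eq_zero_of_mem_frontier hx, hdom.eq_zero_of_mem_frontier hy, sub_self,
    zero_sub, norm_neg, Real.norm_eq_abs] at hd
  rw [dist_eq_norm]
  set d := x - y with hdd
  set r := d - d i • EuclideanSpace.single i (1 : ℝ) with hr
  have hrn : ‖r‖ ≤ n * h := by
    refine EuclideanSpace.norm_le_card_mul fun j => ?_
    by_cases hj : j = i
    · subst hj
      simpa [hr] using hh
    · have := hxy ⟨j, hj⟩
      simpa [hr, hdd, hj] using this
  have hdr : d = d i • EuclideanSpace.single i (1 : ℝ) + r := by rw [hr]; abel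
  have hdn : ‖d‖ ≤ |d i| + ‖r‖ := by
    calc ‖d‖ = ‖d i • EuclideanSpace.single i (1 : ℝ) + r‖ := by rw [← hdr]
      _ ≤ _ := (norm_add_le _ _).trans (by simp [norm_smul])
  have hfd : f d = d i * a + f r := by
    conv_lhs => rw [hdr]
    simp [ha]
  have hfr : |f r| ≤ ‖f‖ * ‖r‖ := f.le_opNorm r
  have h1 : |d i| * |a| ≤ |a| / 2 * (|d i| + ‖r‖) + ‖f‖ * ‖r‖ := by
    calc |d i| * |a| = |f d - f r| := by rw [hfd, ← abs_mul]; congr 1; ring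
      _ ≤ |f d| + |f r| := abs_sub _ _
      _ ≤ |a| / 2 * ‖d‖ + ‖f‖ * ‖r‖ := add_le_add hd hfr
      _ ≤ _ := by gcongr
  have h2 : |d i| ≤ (1 + 2 * ‖f‖ / |a|) * ‖r‖ := by
    have h3 : (1 + 2 * ‖f‖ / |a|) * ‖r‖ = (|a| * ‖r‖ + 2 * ‖f‖ * ‖r‖) / |a| := by field_simp
    rw [h3, le_div_iff₀ ha0]
    linarith
  calc ‖d‖ ≤ (2 + 2 * ‖f‖ / |a|) * ‖r‖ := by linarith
    _ ≤ (2 + 2 * ‖f‖ / |a|) * (n * h) := by gcongr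
    _ = _ := by ring

/-- The boundary is covered by at most `C ρ^{-(n-1)}` balls of radius `ρ / 2`. -/
lemma C2Domain.exists_frontier_net (hdom : C2Domain n Ω F) (δ : ℝ) :
    ∃ C : ℝ, ∀ ρ, 0 < ρ → ρ < δ → ∃ T : Finset (EuclideanSpace ℝ (Fin n)),
      (T : Set (EuclideanSpace ℝ (Fin n))) ⊆ frontier Ω ∧ (T.card : ℝ) ≤ C * (1 / ρ) ^ (n - 1) ∧
      ∀ x ∈ frontier Ω, ∃ t ∈ T, dist x t ≤ ρ / 2 := by
  classical
  have hcpt : IsCompact (frontier Ω) :=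
    hdom.isCompact_closure.of_isClosed_subset isClosed_frontier frontier_subset_closure
  obtain ⟨R, hR⟩ := hcpt.exists_bound_of_continuousOn (continuous_id.continuousOn)
  have key : ∃ C : ℝ, ∀ ρ, 0 < ρ → ρ < δ → ∃ T : Finset (EuclideanSpace ℝ (Fin n)),
      (T : Set (EuclideanSpace ℝ (Fin n))) ⊆ frontier Ω ∧ (T.card : ℝ) ≤ C * (1 / ρ) ^ (n - 1) ∧
      ∀ x ∈ frontier Ω ∩ frontier Ω, ∃ t ∈ T, dist x t ≤ ρ / 2 := by
    refine hcpt.induction_on (p := fun s => ∃ C : ℝ, ∀ ρ, 0 < ρ → ρ < δ →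
      ∃ T : Finset (EuclideanSpace ℝ (Fin n)), (T : Set (EuclideanSpace ℝ (Fin n))) ⊆ frontier Ω ∧
      (T.card : ℝ) ≤ C * (1 / ρ) ^ (n - 1) ∧
      ∀ x ∈ s ∩ frontier Ω, ∃ t ∈ T, dist x t ≤ ρ / 2) ?_ ?_ ?_ ?_
    · exact ⟨0, fun ρ _ _ => ⟨∅, by simp, by simp, fun x hx => absurd hx.1 (notMem_empty x)⟩⟩
    · rintro s t hst ⟨C, hC⟩
      refine ⟨C, fun ρ h0 h1 => ?_⟩
      obtain ⟨T, hT, hTc, hTx⟩ := hC ρ h0 h1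
      exact ⟨T, hT, hTc, fun x hx => hTx x ⟨hst hx.1, hx.2⟩⟩
    · rintro s t ⟨C₁, h₁⟩ ⟨C₂, h₂⟩
      refine ⟨C₁ + C₂, fun ρ h0 h1 => ?_⟩
      obtain ⟨T₁, hT₁, hTc₁, hTx₁⟩ := h₁ ρ h0 h1
      obtain ⟨T₂, hT₂, hTc₂, hTx₂⟩ := h₂ ρ h0 h1
      refine ⟨T₁ ∪ T₂, by simpa using ⟨hT₁, hT₂⟩, ?_, ?_⟩
      · calc ((T₁ ∪ T₂).card : ℝ) ≤ T₁.card + T₂.card := by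
              exact_mod_cast Finset.card_union_le T₁ T₂
          _ ≤ _ := by rw [add_mul]; exact add_le_add hTc₁ hTc₂
      · rintro x ⟨hx | hx, hxf⟩
        · obtain ⟨y, hy, hxy⟩ := hTx₁ x ⟨hx, hxf⟩
          exact ⟨y, Finset.mem_union_left _ hy, hxy⟩
        · obtain ⟨y, hy, hxy⟩ := hTx₂ x ⟨hx, hxf⟩
          exact ⟨y, Finset.mem_union_right _ hy, hxy⟩
    intro p hp
    obtain ⟨i, C, hC, U, hU, hlip⟩ := hdom.exists_frontier_lipschitz hp
    have hR0 : 0 ≤ R := (norm_nonneg _).trans (hR p hp)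
    refine ⟨U, mem_nhdsWithin_of_mem_nhds hU, (4 * R * C + 3 * δ) ^ (n - 1), fun ρ h0 h1 => ?_⟩
    have hh : 0 < ρ / (2 * C) := by positivity
    obtain ⟨T, hT, hTc, hTx⟩ := exists_finset_net (ι := {j : Fin n // j ≠ i}) (U ∩ frontier Ω)
      (fun x j => x j) hR0
      (fun x hx j => (PiLp.norm_apply_le x j.1).trans (hR x hx.2)) hh
    refine ⟨T, hT.trans inter_subset_right, hTc.trans ?_, ?_⟩
    · have hcard : Fintype.card {j : Fin n // j ≠ i} = n - 1 := by
        simp [Fintype.card_subtype_compl]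
      rw [hcard, ← mul_pow]
      have h2 : 2 * (R / (ρ / (2 * C))) + 3 ≤ (4 * R * C + 3 * δ) * (1 / ρ) := by
        have h3 : 2 * (R / (ρ / (2 * C))) + 3 = (4 * R * C + 3 * ρ) * (1 / ρ) := by
          field_simp
          ring
        rw [h3]
        gcongr
      gcongr
    · intro x hx
      obtain ⟨t, ht, hxt⟩ := hTx x hx
      refine ⟨t, ht, (hlip x hx t (hT ht) _ hh.le hxt).trans_eq ?_⟩
      field_simp
  obtain ⟨C, hC⟩ := key
  refine ⟨C, fun ρ h0 h1 => ?_⟩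
  obtain ⟨T, hT, hTc, hTx⟩ := hC ρ h0 h1
  exact ⟨T, hT, hTc, fun x hx => hTx x ⟨hx, hx⟩⟩

end Covering

lemma setIntegral_le_sum_of_subset_biUnion {X ι : Type*} [MeasurableSpace X] {μ : Measure X}
    {f : X → ℝ} (hf : ∀ x, 0 ≤ f x) {Ω A : Set X} {T : Finset ι} {b : ι → Set X}
    (hΩ : MeasurableSet Ω) (hA : MeasurableSet A)
    (hb : ∀ t ∈ T, MeasurableSet (b t)) (hint : IntegrableOn f Ω μ)
    (hsub : ∀ x ∈ Ω ∩ A, ∃ t ∈ T, x ∈ b t) :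
    ∫ x in Ω ∩ A, f x ∂μ ≤ ∑ t ∈ T, ∫ x in b t ∩ Ω, f x ∂μ := by
  have h1 : ∫ x in Ω, A.indicator f x ∂μ ≤ ∫ x in Ω, ∑ t ∈ T, (b t).indicator f x ∂μ := by
    refine setIntegral_mono_on (hint.indicator hA)
      (integrable_finsetSum _ fun t ht => hint.indicator (hb t ht)) hΩ fun x hx => ?_
    have hnn : ∀ t ∈ T, 0 ≤ (b t).indicator f x := fun t _ => indicator_nonneg (fun x _ => hf x) x
    by_cases hxA : x ∈ A
    · obtain ⟨t, ht, hxt⟩ := hsub x ⟨hx, hxA⟩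
      calc A.indicator f x = (b t).indicator f x := by
            rw [indicator_of_mem hxA, indicator_of_mem hxt]
        _ ≤ _ := Finset.single_le_sum hnn ht
    · rw [indicator_of_notMem hxA]
      exact Finset.sum_nonneg hnn
  rw [setIntegral_indicator hA, integral_finsetSum _ fun t ht => hint.indicator (hb t ht)] at h1
  refine h1.trans_eq (Finset.sum_congr rfl fun t ht => ?_)
  rw [setIntegral_indicator (hb t ht), inter_comm]

/-- **Existence of a good boundary point.**
Let `Ω ⊂ ℝⁿ` be a bounded `C²` domain and `δ > 0` be such that `(y,t) ↦ y + tν(y)` is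
one-to-one from `∂Ω × (-δ,δ)` onto the `δ`-neighbourhood of `∂Ω`. Then for every
`ρ < δ` and every Steklov eigenfunction `u` (with any eigenvalue `λ > 0`) there is a
point `y* ∈ ∂Ω` with `∫_Ω u² ≤ C ρ^{-2n+1} ∫_{B(y*,ρ) ∩ Ω} u²`, where `C` depends only
on `Ω`. -/
theorem steklov_special_point (n : ℕ) (Ω : Set (EuclideanSpace ℝ (Fin n)))
    (F : EuclideanSpace ℝ (Fin n) → ℝ) (hdom : C2Domain n Ω F) (δ : ℝ) (hδ : 0 < δ)
    (hinj : ∀ y₁ ∈ frontier Ω, ∀ y₂ ∈ frontier Ω, ∀ t₁ ∈ Ioo (-δ) δ, ∀ t₂ ∈ Ioo (-δ) δ,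
      y₁ + t₁ • normalOf F y₁ = y₂ + t₂ • normalOf F y₂ → y₁ = y₂ ∧ t₁ = t₂)
    (hmaps : ∀ y ∈ frontier Ω, ∀ t ∈ Ioo (-δ) δ,
      infDist (y + t • normalOf F y) (frontier Ω) < δ)
    (hsurj : ∀ x : EuclideanSpace ℝ (Fin n), infDist x (frontier Ω) < δ →
      ∃ y ∈ frontier Ω, ∃ t ∈ Ioo (-δ) δ, x = y + t • normalOf F y) :
    ∃ C : ℝ, 0 < C ∧ ∀ ρ : ℝ, 0 < ρ → ρ < δ →
      ∀ lam : ℝ, 0 < lam → ∀ u : EuclideanSpace ℝ (Fin n) → ℝ,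
        IsSteklov Ω (normalOf F) lam u →
        ∃ ystar ∈ frontier Ω,
          (∫ x in Ω, (u x) ^ 2) ≤
            C * ρ ^ (-2 * (n : ℝ) + 1) * ∫ x in ball ystar ρ ∩ Ω, (u x) ^ 2 := by
  have hfr : (frontier Ω).Nonempty := by
    by_contra h
    rw [not_nonempty_iff_eq_empty] at h
    obtain ⟨y, hy, -⟩ := hsurj 0 (by simpa [h] using hδ)
    simp [h] at hy
  obtain ⟨p, hp⟩ := hfr
  obtain ⟨i, -⟩ := hdom.exists_partial_ne_zero hp
  have hn : 0 < n := i.pos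
  obtain ⟨C₁, hC₁, hcollar⟩ := hdom.exists_collar_estimate hn hδ
  obtain ⟨C₂, hC₂⟩ := hdom.exists_frontier_net δ
  refine ⟨C₁ * (|C₂| + 1) * δ ^ (n - 1), by positivity, ?_⟩
  intro ρ hρ hρδ lam _ u hu
  obtain ⟨hu2, hu1, hharm, -, -⟩ := hu
  obtain ⟨T, hTf, hTc, hTx⟩ := hC₂ ρ hρ hρδ
  have hT : T.Nonempty := by
    obtain ⟨t, ht, -⟩ := hTx p hp
    exact ⟨t, ht⟩
  obtain ⟨y, hyT, hymax⟩ := T.exists_max_image (fun t => ∫ x in ball t ρ ∩ Ω, u x ^ 2) hT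
  refine ⟨y, hTf hyT, ?_⟩
  set J := ∫ x in ball y ρ ∩ Ω, u x ^ 2 with hJ
  have hJ0 : 0 ≤ J := integral_nonneg fun x => sq_nonneg _
  have hcol := hcollar ρ hρ hρδ u hu2 hu1.continuousOn hharm
  have hcover : ∫ x in Ω ∩ {x | infDist x (frontier Ω) < ρ / 2}, u x ^ 2 ≤
      ∑ t ∈ T, ∫ x in ball t ρ ∩ Ω, u x ^ 2 := by
    refine setIntegral_le_sum_of_subset_biUnion (fun x => sq_nonneg (u x))
      hdom.isOpen.measurableSet
      (isOpen_lt (continuous_infDist_pt _) continuous_const).measurableSet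
      (fun t _ => isOpen_ball.measurableSet)
      (((hu1.continuousOn.pow 2).integrableOn_compact hdom.isCompact_closure).mono_set
        subset_closure) ?_
    rintro x ⟨-, hx⟩
    obtain ⟨z, hz, hxz⟩ := (infDist_lt_iff ⟨p, hp⟩).1 hx
    obtain ⟨t, ht, hzt⟩ := hTx z hz
    refine ⟨t, ht, mem_ball.2 ?_⟩
    linarith [dist_triangle x z t]
  have hsum : ∑ t ∈ T, ∫ x in ball t ρ ∩ Ω, u x ^ 2 ≤ T.card * J := by
    simpa using Finset.sum_le_card_nsmul T _ J hymax
  have hTc' : (T.card : ℝ) ≤ (|C₂| + 1) * (1 / ρ) ^ (n - 1) :=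
    hTc.trans (mul_le_mul_of_nonneg_right (by linarith [le_abs_self C₂]) (by positivity))
  have hpow : 1 / ρ * (1 / ρ) ^ (n - 1) ≤ δ ^ (n - 1) * ρ ^ (-2 * (n : ℝ) + 1) := by
    have hr : ρ ^ (-2 * (n : ℝ) + 1) = 1 / ρ * (1 / ρ) ^ (n - 1) * (1 / ρ) ^ (n - 1) := by
      have h1 : -2 * (n : ℝ) + 1 = -((2 * (n - 1) + 1 : ℕ) : ℝ) := by
        have : ((n - 1 : ℕ) : ℝ) = n - 1 := by
          rw [Nat.cast_sub hn]; norm_num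
        push_cast
        rw [this]
        ring
      rw [h1, Real.rpow_neg hρ.le, Real.rpow_natCast, one_div, inv_pow, pow_succ, two_mul, pow_add]
      field_simp
    have hone : 1 ≤ δ ^ (n - 1) * (1 / ρ) ^ (n - 1) := by
      rw [← mul_pow]
      refine one_le_pow₀ ?_
      rw [mul_one_div, le_div_iff₀ hρ]
      linarith
    rw [hr]
    calc 1 / ρ * (1 / ρ) ^ (n - 1)
        ≤ 1 / ρ * (1 / ρ) ^ (n - 1) * (δ ^ (n - 1) * (1 / ρ) ^ (n - 1)) :=
          le_mul_of_one_le_right (by positivity) hone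
      _ = _ := by ring
  calc ∫ x in Ω, u x ^ 2 ≤ C₁ / ρ * (T.card * J) :=
        hcol.trans (mul_le_mul_of_nonneg_left (hcover.trans hsum) (by positivity))
    _ ≤ C₁ / ρ * ((|C₂| + 1) * (1 / ρ) ^ (n - 1) * J) := by gcongr
    _ = C₁ * (|C₂| + 1) * J * (1 / ρ * (1 / ρ) ^ (n - 1)) := by ring
    _ ≤ C₁ * (|C₂| + 1) * J * (δ ^ (n - 1) * ρ ^ (-2 * (n : ℝ) + 1)) := by gcongr
    _ = _ := by ring
end
end
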